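/- arXiv:0910.2494 — 3 statements merged into one kernel-verified Lean document; each statement's English description precedes it below -/
import Mathlib

section
/- Let φ_σ = φ̂_σ be the hat kernel, let ω > 0 and z ∈ ℬ_ω, set f_σ = φ̂_σ * z, and let λ > 0. If σ ≤ ω and (2/3)σ + 2/λ < ω, then u = z is the unique minimiser of F₁(u) = ∫_ℝ |u′| + λ‖u − f_σ‖²_{L²(ℝ)} over ℬ, i.e. F₁(z) < F₁(u) for every u ∈ ℬ with u ≠ z a.e. -/
open MeasureTheory Set

noncomputable section

/-- The total variation `∫_ℝ |u'|` of a function `u : ℝ → ℝ`. -/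
def TV (u : ℝ → ℝ) : ENNReal := eVariationOn u Set.univ

/-- Convolution `(φ * u)(x) = ∫_ℝ φ(x − y) u(y) dy`. -/
def conv (φ u : ℝ → ℝ) : ℝ → ℝ := fun x => ∫ y : ℝ, φ (x - y) * u y

/-- Membership of `φ` in the kernel class `𝒦`, with parameter `σ` and profile `p`:
`φ(x) = p(|x|) χ_{[−σ,σ]}(x)` with `p ≥ 0` monotonically decreasing on `[0,σ]`
and `∫₀^σ p = 1/2`; in particular `φ ∈ L¹(ℝ)`. -/
def IsKernelWith (φ : ℝ → ℝ) (p : ℝ → ℝ) (σ : ℝ) : Prop :=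
  0 < σ ∧ Integrable φ ∧
    (∀ x ∈ Icc (0:ℝ) σ, 0 ≤ p x) ∧ AntitoneOn p (Icc (0:ℝ) σ) ∧
    (∫ x in (0:ℝ)..σ, p x) = 1 / 2 ∧
    ∀ x : ℝ, φ x = if |x| ≤ σ then p |x| else 0

/-- The hat kernel `φ̂_σ(x) = (1 − |x|/σ)/σ` for `|x| < σ`, `0` otherwise. -/
def hatKernel (σ : ℝ) : ℝ → ℝ := fun x => if |x| < σ then (1 - |x| / σ) / σ else 0

/-- The dual norm `‖f‖_* = sup { |∫ f v| : v ∈ L¹(ℝ), ∫_ℝ |v'| ≤ 1 }`. -/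
def starNorm (f : ℝ → ℝ) : ENNReal :=
  ⨆ (v : ℝ → ℝ) (_ : Integrable v ∧ TV v ≤ 1), ENNReal.ofReal |∫ x : ℝ, f x * v x|

/-- Structural description of a bar code: `n` bars with interface points
`t 0 < t 1 < ⋯ < t (2n−1)` inside `[0,1]`; the bars are the intervals
`[t (2k), t (2k+1)]`, `k < n`. -/
structure BarcodeRep where
  n : ℕ
  t : ℕ → ℝ
  mono : StrictMonoOn t (Set.Iio (2 * n))
  left : n ≠ 0 → 0 ≤ t 0
  right : n ≠ 0 → t (2 * n - 1) ≤ 1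

/-- The support of a bar code: the union of its (closed) bars. -/
def BarcodeRep.supp (B : BarcodeRep) : Set ℝ :=
  ⋃ k ∈ Finset.range B.n, Icc (B.t (2 * k)) (B.t (2 * k + 1))

/-- The bar code as a function: the characteristic function of the union of its bars. -/
def BarcodeRep.fn (B : BarcodeRep) : ℝ → ℝ := B.supp.indicator fun _ => (1:ℝ)

/-- `x` is an interface location (an endpoint of a bar) of the bar code `B`. -/
def BarcodeRep.IsInterface (B : BarcodeRep) (x : ℝ) : Prop := ∃ k < 2 * B.n, B.t k = x

/-- All bars and all (maximal, nonempty) spaces in `[0,1]` of the bar code `B`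
have width at least `ω`. -/
def BarcodeRep.MinWidth (B : BarcodeRep) (ω : ℝ) : Prop :=
  (∀ k < B.n, ω ≤ B.t (2 * k + 1) - B.t (2 * k)) ∧
  (∀ k, k + 1 < B.n → ω ≤ B.t (2 * k + 2) - B.t (2 * k + 1)) ∧
  (B.n ≠ 0 → 0 < B.t 0 → ω ≤ B.t 0) ∧
  (B.n ≠ 0 → B.t (2 * B.n - 1) < 1 → ω ≤ 1 - B.t (2 * B.n - 1))

/-- Membership in `ℬ`: `u` is (the standard representative of) a bar code. -/
def IsBarcode (u : ℝ → ℝ) : Prop := ∃ B : BarcodeRep, u = B.fn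

/-- Membership in `ℬ_ω`. -/
def IsBarcodeW (u : ℝ → ℝ) (ω : ℝ) : Prop := ∃ B : BarcodeRep, u = B.fn ∧ B.MinWidth ω

/-- Membership in `ℬ^{ij}`: `u = i` on `[0,x₁]` and `u = j` on `[x₂,1]` for some
`0 < x₁ ≤ x₂ < 1`. -/
def InBij (u : ℝ → ℝ) (i j : ℝ) : Prop :=
  ∃ x₁ x₂ : ℝ, 0 < x₁ ∧ x₁ ≤ x₂ ∧ x₂ < 1 ∧
    (∀ x ∈ Icc (0:ℝ) x₁, u x = i) ∧ (∀ x ∈ Icc x₂ (1:ℝ), u x = j)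

/-- The `L²` fidelity term `‖g − f‖²_{L²(ℝ)}`, valued in `[0,∞]`
(equal to `∞` if `g − f ∉ L²(ℝ)`). -/
def fidelity (g f : ℝ → ℝ) : ENNReal := ∫⁻ x : ℝ, ENNReal.ofReal ((g x - f x) ^ 2)

/-- The functional `F₁(u) = ∫_ℝ |u'| + λ ‖u − f‖²_{L²(ℝ)}`. -/
def F1 (lam : ℝ) (f u : ℝ → ℝ) : ENNReal := TV u + ENNReal.ofReal lam * fidelity u f

/-- The (blind) deconvolution functional `F(u) = ∫_ℝ |u'| + λ ‖φ*u − f‖²_{L²(ℝ)}`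
(this is `F₂` when `φ = φ_σ` and `F₃` when `φ = φ_ρ`). -/
def Fker (lam : ℝ) (φ f u : ℝ → ℝ) : ENNReal :=
  TV u + ENNReal.ofReal lam * fidelity (conv φ u) f

def pp (s : ℝ) : ℝ := max s 0

lemma pp_cont : Continuous pp := by unfold pp; fun_prop

lemma pp_pow_deriv (n : ℕ) (hn : 2 ≤ n) (c s : ℝ) :
    HasDerivAt (fun s => (pp (s + c)) ^ n) (n * (pp (s + c)) ^ (n - 1)) s := by
  have key : ∀ x : ℝ, HasDerivAt (fun s => (pp s) ^ n) (n * (pp x) ^ (n - 1)) x := by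
    intro x
    rcases lt_trichotomy x 0 with h | h | h
    · have : pp x = 0 := max_eq_right h.le
      rw [this, zero_pow (by omega), mul_zero]
      apply (hasDerivAt_const x (0:ℝ)).congr_of_eventuallyEq
      filter_upwards [Iio_mem_nhds h] with y hy
      have : pp y = 0 := max_eq_right (le_of_lt hy)
      rw [this, zero_pow (by omega)]
    · subst h
      have : pp 0 = 0 := max_eq_right le_rfl
      rw [this, zero_pow (by omega), mul_zero]
      rw [hasDerivAt_iff_isLittleO_nhds_zero]
      have h1 : (fun h : ℝ => h ^ n) =o[nhds 0] fun h => h := by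
        simpa using Asymptotics.isLittleO_pow_pow (𝕜 := ℝ) (m := 1) (n := n) (by omega)
      refine Asymptotics.IsBigO.trans_isLittleO ?_ h1
      apply Asymptotics.IsBigO.of_bound 1
      filter_upwards with y
      simp only [zero_add, this, zero_pow (show n ≠ 0 by omega), smul_zero, sub_zero, one_mul, norm_pow]
      gcongr
      unfold pp
      rw [Real.norm_eq_abs, Real.norm_eq_abs, abs_of_nonneg (le_max_right _ _)]
      exact max_le (le_abs_self _) (abs_nonneg _)
    · have : pp x = x := max_eq_left h.le
      rw [this]
      apply (hasDerivAt_pow n x).congr_of_eventuallyEq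
      filter_upwards [Ioi_mem_nhds h] with y hy
      have : pp y = y := max_eq_left (le_of_lt hy)
      simp only [this]
  exact (key (s + c)).comp_add_const s c

def Phi (σ s : ℝ) : ℝ := ((pp (s + σ)) ^ 2 - 2 * (pp (s + 0)) ^ 2 + (pp (s + -σ)) ^ 2) / (2 * σ ^ 2)

def Phi3 (σ s : ℝ) : ℝ := ((pp (s + σ)) ^ 3 - 2 * (pp (s + 0)) ^ 3 + (pp (s + -σ)) ^ 3) / (6 * σ ^ 2)

lemma Phi_cont (σ : ℝ) : Continuous (Phi σ) := by
  have := pp_cont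
  unfold Phi; fun_prop

lemma Phi3_deriv (σ s : ℝ) : HasDerivAt (Phi3 σ) (Phi σ s) s := by
  have := ((((pp_pow_deriv 3 (by norm_num) σ s).sub
    ((pp_pow_deriv 3 (by norm_num) 0 s).const_mul 2)).add
    (pp_pow_deriv 3 (by norm_num) (-σ) s))).div_const (6 * σ ^ 2)
  refine this.congr_deriv ?_
  unfold Phi
  by_cases h : σ = 0
  · simp [h]
  · field_simp; norm_num; ring

lemma hat_eq (σ : ℝ) (hσ : 0 < σ) (s : ℝ) :
    hatKernel σ s = (pp (s + σ) - 2 * pp (s + 0) + pp (s + -σ)) / σ ^ 2 := by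
  unfold hatKernel pp
  split_ifs with h
  · rw [abs_lt] at h
    rw [max_eq_left (by linarith : 0 ≤ s + σ), max_eq_right (by linarith : s + -σ ≤ 0)]
    rcases le_total 0 s with h' | h'
    · rw [abs_of_nonneg h', max_eq_left (by linarith)]; field_simp; ring
    · rw [abs_of_nonpos h', max_eq_right (by linarith)]; field_simp; ring
  · rw [not_lt, le_abs] at h
    rcases h with h | h
    · rw [max_eq_left (by linarith), max_eq_left (by linarith), max_eq_left (by linarith)]
      field_simp; ring
    · rw [max_eq_right (by linarith), max_eq_right (by linarith), max_eq_right (by linarith)]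
      simp

lemma Phi_deriv (σ : ℝ) (hσ : 0 < σ) (s : ℝ) : HasDerivAt (Phi σ) (hatKernel σ s) s := by
  have := ((((pp_pow_deriv 2 (by norm_num) σ s).sub
    ((pp_pow_deriv 2 (by norm_num) 0 s).const_mul 2)).add
    (pp_pow_deriv 2 (by norm_num) (-σ) s))).div_const (2 * σ ^ 2)
  refine this.congr_deriv ?_
  rw [hat_eq σ hσ]
  field_simp; norm_num

lemma hat_cont (σ : ℝ) (hσ : 0 < σ) : Continuous (hatKernel σ) := by
  have := pp_cont
  rw [show hatKernel σ = _ from funext (hat_eq σ hσ)]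
  fun_prop

lemma Phi_mono (σ : ℝ) (hσ : 0 < σ) : Monotone (Phi σ) := by
  apply monotone_of_deriv_nonneg (fun s => (Phi_deriv σ hσ s).differentiableAt)
  intro s
  rw [(Phi_deriv σ hσ s).deriv]
  unfold hatKernel
  split_ifs with h
  · have : |s| / σ ≤ 1 := by rw [div_le_one hσ]; exact h.le
    apply div_nonneg _ hσ.le; linarith
  · exact le_rfl

lemma Phi_low (σ s : ℝ) (h : s ≤ -σ) (hσ : 0 < σ) : Phi σ s = 0 := by
  unfold Phi pp
  rw [max_eq_right (by linarith), max_eq_right (by linarith), max_eq_right (by linarith)]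
  simp

lemma Phi_high (σ s : ℝ) (h : σ ≤ s) (hσ : 0 < σ) : Phi σ s = 1 := by
  unfold Phi pp
  rw [max_eq_left (by linarith), max_eq_left (by linarith), max_eq_left (by linarith)]
  field_simp; ring

lemma Phi_mid (σ s : ℝ) (h0 : 0 ≤ s) (h : s ≤ σ) (hσ : 0 < σ) :
    Phi σ s = 1 - (σ - s) ^ 2 / (2 * σ ^ 2) := by
  unfold Phi pp
  rw [max_eq_left (by linarith), max_eq_left (by linarith), max_eq_right (by linarith)]
  field_simp; ring

lemma Phi_midneg (σ s : ℝ) (h0 : s ≤ 0) (h : -σ ≤ s) (hσ : 0 < σ) :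
    Phi σ s = (σ + s) ^ 2 / (2 * σ ^ 2) := by
  unfold Phi pp
  rw [max_eq_left (by linarith), max_eq_right (by linarith), max_eq_right (by linarith)]
  field_simp; ring

lemma Phi_nonneg (σ s : ℝ) (hσ : 0 < σ) : 0 ≤ Phi σ s := by
  rcases le_total s (-σ) with h | h
  · rw [Phi_low σ s h hσ]
  · rw [← Phi_low σ (-σ) le_rfl hσ]; exact Phi_mono σ hσ h

lemma Phi_le_one (σ s : ℝ) (hσ : 0 < σ) : Phi σ s ≤ 1 := by
  rcases le_total s σ with h | h
  · rw [← Phi_high σ σ le_rfl hσ]; exact Phi_mono σ hσ h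
  · rw [Phi_high σ s h hσ]

lemma Phi_symm (σ s : ℝ) (hσ : 0 < σ) : Phi σ (-s) = 1 - Phi σ s := by
  rcases le_total s (-σ) with h | h
  · rw [Phi_low σ s h hσ, Phi_high _ _ (by linarith) hσ]; norm_num
  rcases le_total σ s with h' | h'
  · rw [Phi_low σ (-s) (by linarith) hσ, Phi_high _ _ (by linarith) hσ]; norm_num
  rcases le_total 0 s with h'' | h''
  · rw [Phi_mid σ s h'' h' hσ, Phi_midneg σ (-s) (by linarith) (by linarith) hσ]; ring
  · rw [Phi_midneg σ s h'' h hσ, Phi_mid σ (-s) (by linarith) (by linarith) hσ]; ring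

lemma Phi_gt_half (σ s : ℝ) (hs : 0 < s) (hσ : 0 < σ) : 1 / 2 < Phi σ s := by
  rcases le_total σ s with h' | h'
  · rw [Phi_high _ _ (by linarith) hσ]; norm_num
  · rw [Phi_mid σ s hs.le h' hσ]
    have : (σ - s) ^ 2 / (2 * σ ^ 2) < 1 / 2 := by
      rw [div_lt_iff₀ (by positivity)]; nlinarith
    linarith

lemma Phi_pair (σ p q : ℝ) (hp : 0 < p) (hq : 0 < q) (h : σ ≤ p + q) (hσ : 0 < σ) :
    1 / 2 < Phi σ p + Phi σ q - 1 := by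
  rcases le_total σ p with h' | h'
  · rw [Phi_high _ _ h' hσ]; linarith [Phi_gt_half σ q hq hσ]
  rcases le_total σ q with h'' | h''
  · rw [Phi_high _ _ h'' hσ]; linarith [Phi_gt_half σ p hp hσ]
  rw [Phi_mid σ p hp.le h' hσ, Phi_mid σ q hq.le h'' hσ]
  have : (σ - p) ^ 2 / (2 * σ ^ 2) + (σ - q) ^ 2 / (2 * σ ^ 2) < 1 / 2 := by
    rw [← add_div, div_lt_iff₀ (by positivity)]
    nlinarith [mul_pos hp hq, mul_nonneg (sub_nonneg.2 h') (sub_nonneg.2 h''), mul_pos hp hσ, mul_pos hq hσ]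
  linarith

lemma Phi_int (σ L : ℝ) (hL : σ ≤ L) (hσ : 0 < σ) : ∫ s in (0:ℝ)..L, Phi σ s = L - σ / 6 := by
  rw [intervalIntegral.integral_eq_sub_of_hasDerivAt (fun s _ => Phi3_deriv σ s)
    ((Phi_cont σ).intervalIntegrable _ _)]
  unfold Phi3 pp
  rw [max_eq_left (by linarith), max_eq_left (by linarith), max_eq_left (by linarith),
    max_eq_left (by linarith), max_eq_left (by linarith), max_eq_right (by linarith)]
  field_simp; ring

lemma Phi_int2 (σ a b : ℝ) (hL : σ ≤ b - a) (hσ : 0 < σ) :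
    ∫ x in a..b, (2 * (Phi σ (x - a) + Phi σ (b - x) - 1) - 1) = (b - a) - 2 / 3 * σ := by
  have c := Phi_cont σ
  have e1 : ∫ x in a..b, Phi σ (x - a) = (b - a) - σ / 6 := by
    rw [intervalIntegral.integral_comp_sub_right (fun x => Phi σ x), sub_self, Phi_int σ _ hL hσ]
  have e2 : ∫ x in a..b, Phi σ (b - x) = (b - a) - σ / 6 := by
    rw [intervalIntegral.integral_comp_sub_left (fun x => Phi σ x), sub_self, Phi_int σ _ hL hσ]
  rw [show (fun x => 2 * (Phi σ (x - a) + Phi σ (b - x) - 1) - 1) =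
    fun x => (2 * Phi σ (x - a) + 2 * Phi σ (b - x)) - 3 by ext; ring]
  rw [intervalIntegral.integral_sub, intervalIntegral.integral_add,
    intervalIntegral.integral_const_mul, intervalIntegral.integral_const_mul, e1, e2,
    intervalIntegral.integral_const]
  · simp only [smul_eq_mul]; ring
  all_goals (apply Continuous.intervalIntegrable; fun_prop)

lemma hat_conv_Icc (σ a b x : ℝ) (hab : a ≤ b) (hσ : 0 < σ) :
    ∫ y : ℝ, hatKernel σ (x - y) * (Icc a b).indicator (fun _ => (1:ℝ)) y
      = Phi σ (x - a) - Phi σ (x - b) := by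
  have : ∀ y, hatKernel σ (x - y) * (Icc a b).indicator (fun _ => (1:ℝ)) y =
      (Icc a b).indicator (fun y => hatKernel σ (x - y)) y := by
    intro y; by_cases h : y ∈ Icc a b <;> simp [h]
  simp_rw [this]
  rw [integral_indicator measurableSet_Icc, integral_Icc_eq_integral_Ioc,
    ← intervalIntegral.integral_of_le hab,
    intervalIntegral.integral_comp_sub_left (fun y => hatKernel σ y),
    intervalIntegral.integral_eq_sub_of_hasDerivAt (fun s _ => Phi_deriv σ hσ s)
    ((hat_cont σ hσ).intervalIntegrable _ _)]

lemma eVar_add_le (f g : ℝ → ℝ) (s : Set ℝ) :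
    eVariationOn (fun x => f x + g x) s ≤ eVariationOn f s + eVariationOn g s := by
  apply iSup_le
  rintro ⟨n, u, hu, us⟩
  calc ∑ i ∈ Finset.range n, edist (f (u (i + 1)) + g (u (i + 1))) (f (u i) + g (u i))
      ≤ ∑ i ∈ Finset.range n, (edist (f (u (i + 1))) (f (u i)) + edist (g (u (i + 1))) (g (u i))) :=
        Finset.sum_le_sum fun i _ => edist_add_add_le _ _ _ _
    _ ≤ _ := by
        rw [Finset.sum_add_distrib]
        exact add_le_add (eVariationOn.sum_le hu us) (eVariationOn.sum_le hu us)

lemma eVar_mono_le_one (f : ℝ → ℝ) (s : Set ℝ) (hf : MonotoneOn f s) (h0 : ∀ x, 0 ≤ f x)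
    (h1 : ∀ x, f x ≤ 1) : eVariationOn f s ≤ 1 := by
  rw [eVariationOn.eq_biSup_inter_Icc]
  apply iSup₂_le
  rintro ⟨a, b⟩ ⟨ha, hb, hab⟩
  dsimp only at *
  rw [hf.eVariationOn_eq ha hb, ← ENNReal.ofReal_one]
  apply ENNReal.ofReal_le_ofReal
  linarith [h0 a, h1 b]

lemma eVar_anti_le_one (f : ℝ → ℝ) (s : Set ℝ) (hf : AntitoneOn f s) (h0 : ∀ x, 0 ≤ f x)
    (h1 : ∀ x, f x ≤ 1) : eVariationOn f s ≤ 1 := by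
  have := eVar_mono_le_one (fun x => 1 - f x) s
    (fun x hx y hy h => by have := hf hx hy h; dsimp only; linarith)
    (fun x => by linarith [h1 x]) (fun x => by linarith [h0 x])
  refine le_trans (le_of_eq ?_) this
  unfold eVariationOn
  simp only [edist_sub_left]

lemma eVar_Icc (a b : ℝ) :
    eVariationOn ((Icc a b).indicator (fun _ => (1:ℝ))) univ ≤ 2 := by
  have h0 : ∀ x, 0 ≤ (Icc a b).indicator (fun _ => (1:ℝ)) x :=
    fun x => indicator_nonneg (fun _ _ => zero_le_one) x
  have h1 : ∀ x, (Icc a b).indicator (fun _ => (1:ℝ)) x ≤ 1 :=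
    fun x => indicator_le_self' (fun _ _ => zero_le_one) x
  rw [← Iic_union_Ici (a := b), eVariationOn.union _ isGreatest_Iic isLeast_Ici]
  have e1 : MonotoneOn ((Icc a b).indicator (fun _ => (1:ℝ))) (Iic b) := by
    intro x hx y hy hxy
    by_cases h : x ∈ Icc a b
    · have : y ∈ Icc a b := ⟨h.1.trans hxy, hy⟩
      simp [h, this]
    · rw [indicator_of_notMem h]; exact h0 y
  have e2 : AntitoneOn ((Icc a b).indicator (fun _ => (1:ℝ))) (Ici b) := by
    intro x hx y hy hxy
    by_cases h : y ∈ Icc a b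
    · have : x = y := le_antisymm hxy (h.2.trans hx)
      rw [this]
    · rw [indicator_of_notMem h]; exact h0 x
  calc _ ≤ (1:ENNReal) + 1 := add_le_add (eVar_mono_le_one _ _ e1 h0 h1) (eVar_anti_le_one _ _ e2 h0 h1)
    _ = 2 := by norm_num

lemma BarcodeRep.lt (B : BarcodeRep) {i j : ℕ} (h : i < j) (hj : j < 2 * B.n) : B.t i < B.t j :=
  B.mono (mem_Iio.2 (h.trans hj)) (mem_Iio.2 hj) h

lemma BarcodeRep.le (B : BarcodeRep) {i j : ℕ} (h : i ≤ j) (hj : j < 2 * B.n) : B.t i ≤ B.t j := by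
  rcases h.eq_or_lt with rfl | h
  · exact le_rfl
  · exact (B.lt h hj).le

lemma BarcodeRep.fn_sum (B : BarcodeRep) (x : ℝ) :
    B.fn x = ∑ k ∈ Finset.range B.n,
      (Icc (B.t (2 * k)) (B.t (2 * k + 1))).indicator (fun _ => (1:ℝ)) x := by
  unfold BarcodeRep.fn BarcodeRep.supp
  rw [Finset.indicator_biUnion_apply]
  intro i hi j hj hij
  rw [Finset.mem_coe, Finset.mem_range] at hi hj
  rw [Function.onFun, Set.disjoint_left]
  rintro y ⟨h1, h2⟩ ⟨h3, h4⟩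
  rcases lt_or_gt_of_ne hij with h | h
  · have := B.lt (i := 2 * i + 1) (j := 2 * j) (by omega) (by omega)
    linarith
  · have := B.lt (i := 2 * j + 1) (j := 2 * i) (by omega) (by omega)
    linarith

lemma BarcodeRep.TV_le (B : BarcodeRep) : TV B.fn ≤ 2 * B.n := by
  have : ∀ m : ℕ, eVariationOn (fun x => ∑ k ∈ Finset.range m,
      (Icc (B.t (2 * k)) (B.t (2 * k + 1))).indicator (fun _ => (1:ℝ)) x) univ ≤ 2 * m := by
    intro m
    induction m with
    | zero =>
      simp only [Finset.range_zero, Finset.sum_empty]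
      rw [(eVariationOn.eq_zero_iff _).2 (by simp)]; simp
    | succ m ih =>
      simp only [Finset.sum_range_succ]
      refine (eVar_add_le _ _ _).trans ((add_le_add ih (eVar_Icc _ _)).trans (le_of_eq ?_))
      push_cast; ring
  unfold TV
  rw [show B.fn = _ from funext B.fn_sum]
  exact this _

lemma BarcodeRep.fn_one (B : BarcodeRep) {k : ℕ} (hk : k < B.n) {x : ℝ}
    (h : B.t (2 * k) ≤ x) (h' : x ≤ B.t (2 * k + 1)) : B.fn x = 1 := by
  unfold BarcodeRep.fn BarcodeRep.supp
  rw [indicator_of_mem]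
  simp only [mem_iUnion, Finset.mem_range]
  exact ⟨k, hk, h, h'⟩

lemma BarcodeRep.fn_zero (B : BarcodeRep) {x : ℝ}
    (h : ∀ k < B.n, x < B.t (2 * k) ∨ B.t (2 * k + 1) < x) : B.fn x = 0 := by
  unfold BarcodeRep.fn BarcodeRep.supp
  rw [indicator_of_notMem]
  simp only [mem_iUnion, Finset.mem_range]
  rintro ⟨k, hk, h1, h2⟩
  rcases h k hk with h | h <;> linarith

lemma BarcodeRep.fn_space (B : BarcodeRep) {k : ℕ} (hk : k + 1 < B.n) {x : ℝ}
    (h : B.t (2 * k + 1) < x) (h' : x < B.t (2 * k + 2)) : B.fn x = 0 := by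
  apply B.fn_zero
  intro i hi
  rcases le_or_gt i k with h2 | h2
  · right; exact (B.le (i := 2 * i + 1) (j := 2 * k + 1) (by omega) (by omega)).trans_lt h
  · left; exact h'.trans_le (B.le (i := 2 * k + 2) (j := 2 * i) (by omega) (by omega))

lemma BarcodeRep.fn_left (B : BarcodeRep) {x : ℝ} (h : B.n ≠ 0 → x < B.t 0) : B.fn x = 0 := by
  apply B.fn_zero
  intro i hi
  left; exact (h (by omega)).trans_le (B.le (by omega) (by omega))

lemma BarcodeRep.fn_right (B : BarcodeRep) {x : ℝ} (h : B.n ≠ 0 → B.t (2 * B.n - 1) < x) :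
    B.fn x = 0 := by
  apply B.fn_zero
  intro i hi
  right; exact lt_of_le_of_lt (B.le (by omega) (by omega)) (h (by omega))

lemma BarcodeRep.fn_01 (B : BarcodeRep) (x : ℝ) : B.fn x = 0 ∨ B.fn x = 1 := by
  unfold BarcodeRep.fn
  by_cases h : x ∈ B.supp <;> simp [h]

/-- Lower bound for the variation. -/
lemma BarcodeRep.le_TV (B : BarcodeRep) : 2 * B.n ≤ TV B.fn := by
  by_cases hn : B.n = 0
  · simp [hn]
  have key : ∀ m : ℕ, m < B.n → (2 * m + 1 : ENNReal) ≤ eVariationOn B.fn (Iic (B.t (2 * m + 1))) := by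
    intro m
    induction m with
    | zero =>
      intro _
      have h1 := B.lt (i := 0) (j := 1) (by omega) (by omega)
      refine le_trans ?_ (eVariationOn.edist_le B.fn (x := B.t 0 - 1) (y := B.t 0) ?_ ?_)
      · rw [B.fn_left (x := B.t 0 - 1) (by intro; linarith),
          B.fn_one (k := 0) (x := B.t 0) (by omega) le_rfl h1.le]
        simp [edist_dist]
      · simp only [mem_Iic, mul_zero, zero_add]; linarith
      · simp only [mem_Iic, mul_zero, zero_add]; linarith
    | succ m ih =>
      intro hm
      have h0 := B.lt (i := 2 * m + 1) (j := 2 * m + 2) (by omega) (by omega)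
      have h1 := B.lt (i := 2 * m) (j := 2 * m + 1) (by omega) (by omega)
      have h2 := B.lt (i := 2 * m + 2) (j := 2 * m + 3) (by omega) (by omega)
      set a := B.t (2 * m + 1)
      set b := B.t (2 * m + 2) with hb
      set c := B.t (2 * m + 3) with hc
      have va : B.fn a = 1 := B.fn_one (k := m) (by omega) h1.le le_rfl
      have vb : B.fn b = 1 := B.fn_one (k := m + 1) (by omega) (le_of_eq rfl) h2.le
      have vm : B.fn ((a + b) / 2) = 0 :=
        B.fn_space (k := m) (by omega) (by linarith) (by linarith)
      have e1 : Iic a ∪ (Icc a ((a + b) / 2) ∪ Icc ((a + b) / 2) b) ⊆ Iic c := by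
        rw [Icc_union_Icc_eq_Icc (by linarith) (by linarith), Iic_union_Icc_eq_Iic (by linarith)]
        exact Iic_subset_Iic.2 h2.le
      have e2 := eVariationOn.mono B.fn e1
      rw [eVariationOn.union (x := a) B.fn isGreatest_Iic
        (by rw [Icc_union_Icc_eq_Icc (by linarith) (by linarith)]; exact isLeast_Icc h0.le),
        eVariationOn.union B.fn (isGreatest_Icc (by linarith)) (isLeast_Icc (by linarith))] at e2
      have e3 := eVariationOn.edist_le B.fn (s := Icc a ((a + b) / 2)) (x := a) (y := (a + b) / 2)
        ⟨le_rfl, by linarith⟩ ⟨by linarith, le_rfl⟩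
      have e4 := eVariationOn.edist_le B.fn (s := Icc ((a + b) / 2) b) (x := (a + b) / 2) (y := b)
        ⟨le_rfl, by linarith⟩ ⟨by linarith, le_rfl⟩
      rw [va, vm] at e3
      rw [vm, vb] at e4
      have n1 : edist (1:ℝ) 0 = 1 := by simp [edist_dist]
      have n2 : edist (0:ℝ) 1 = 1 := by simp [edist_dist]
      rw [n1] at e3
      rw [n2] at e4
      have e5 := (add_le_add (ih (by omega)) (add_le_add e3 e4)).trans e2
      refine le_trans (le_of_eq ?_) e5
      push_cast; ring
  have h := key (B.n - 1) (by omega)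
  have hh : 2 * (B.n - 1) + 1 = 2 * B.n - 1 := by omega
  rw [hh] at h
  set a := B.t (2 * B.n - 1) with ha
  have e2 := eVariationOn.mono B.fn (subset_univ (Iic a ∪ Icc a (a + 1)))
  rw [eVariationOn.union (x := a) B.fn isGreatest_Iic (isLeast_Icc (by linarith))] at e2
  have e3 := eVariationOn.edist_le B.fn (s := Icc a (a + 1)) (x := a) (y := a + 1)
        ⟨le_rfl, by linarith⟩ ⟨by linarith, le_rfl⟩
  have h1 := B.lt (i := 2 * (B.n - 1)) (j := 2 * (B.n - 1) + 1) (by omega) (by omega)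
  have va : B.fn a = 1 := B.fn_one (k := B.n - 1) (by omega) (by rw [ha, ← hh]; exact h1.le)
    (by rw [hh])
  have vm : B.fn (a + 1) = 0 := B.fn_right (by intro; linarith)
  rw [va, vm] at e3
  have n1 : edist (1:ℝ) 0 = 1 := by simp [edist_dist]
  rw [n1] at e3
  refine le_trans (le_of_eq ?_) ((add_le_add h e3).trans e2)
  obtain ⟨m, hm⟩ : ∃ m, B.n = m + 1 := ⟨B.n - 1, by omega⟩
  rw [hm]; simp; ring

def BarcodeRep.ff (B : BarcodeRep) (σ x : ℝ) : ℝ :=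
  ∑ k ∈ Finset.range B.n, (Phi σ (x - B.t (2 * k)) - Phi σ (x - B.t (2 * k + 1)))

lemma BarcodeRep.conv_eq (B : BarcodeRep) (σ : ℝ) (hσ : 0 < σ) :
    conv (hatKernel σ) B.fn = B.ff σ := by
  ext x
  unfold conv BarcodeRep.ff
  simp_rw [B.fn_sum, Finset.mul_sum]
  rw [integral_finsetSum]
  · apply Finset.sum_congr rfl
    intro k hk
    rw [Finset.mem_range] at hk
    exact hat_conv_Icc σ _ _ x (B.le (by omega) (by omega)) hσ
  · intro k hk
    have : ∀ y, hatKernel σ (x - y) *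
        (Icc (B.t (2 * k)) (B.t (2 * k + 1))).indicator (fun _ => (1:ℝ)) y =
        (Icc (B.t (2 * k)) (B.t (2 * k + 1))).indicator (fun y => hatKernel σ (x - y)) y := by
      intro y; by_cases h : y ∈ Icc (B.t (2 * k)) (B.t (2 * k + 1)) <;> simp [h]
    simp_rw [this]
    rw [integrable_indicator_iff measurableSet_Icc]
    exact ((hat_cont σ hσ).comp (by fun_prop : Continuous fun y => x - y)).continuousOn.integrableOn_Icc

lemma BarcodeRep.ff_cont (B : BarcodeRep) (σ : ℝ) : Continuous (B.ff σ) := by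
  have := Phi_cont σ
  unfold BarcodeRep.ff
  fun_prop

lemma BarcodeRep.a_anti (B : BarcodeRep) (σ x : ℝ) (hσ : 0 < σ) {i j : ℕ} (h : i ≤ j)
    (hj : j < 2 * B.n) : Phi σ (x - B.t j) ≤ Phi σ (x - B.t i) :=
  Phi_mono σ hσ (by linarith [B.le h hj])

lemma BarcodeRep.ff_supp (B : BarcodeRep) (σ : ℝ) (hσ : 0 < σ) : HasCompactSupport (B.ff σ) := by
  apply HasCompactSupport.intro (isCompact_Icc (a := -σ) (b := 1 + σ))
  intro x hx
  unfold BarcodeRep.ff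
  apply Finset.sum_eq_zero
  intro k hk
  rw [Finset.mem_range] at hk
  have h0 := B.left (by omega)
  have h1 := B.right (by omega)
  have h2 := B.le (i := 0) (j := 2 * k) (by omega) (by omega)
  have h3 := B.le (i := 2 * k) (j := 2 * k + 1) (by omega) (by omega)
  have h4 := B.le (i := 2 * k + 1) (j := 2 * B.n - 1) (by omega) (by omega)
  rw [mem_Icc, not_and_or, not_le, not_le] at hx
  rcases hx with hx | hx
  · rw [Phi_low _ _ (by linarith) hσ, Phi_low _ _ (by linarith) hσ]; simp
  · rw [Phi_high _ _ (by linarith) hσ, Phi_high _ _ (by linarith) hσ]; simp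

lemma BarcodeRep.tail (B : BarcodeRep) (σ x : ℝ) (hσ : 0 < σ) (m d : ℕ) (h : m + d + 1 ≤ B.n) :
    ∑ k ∈ Finset.range (m + d + 1), (Phi σ (x - B.t (2 * k)) - Phi σ (x - B.t (2 * k + 1))) ≤
    ∑ k ∈ Finset.range m, (Phi σ (x - B.t (2 * k)) - Phi σ (x - B.t (2 * k + 1)))
      + Phi σ (x - B.t (2 * m)) - Phi σ (x - B.t (2 * (m + d) + 1)) := by
  induction d with
  | zero => simp only [add_zero, Finset.sum_range_succ]; linarith
  | succ d ih =>
    have h1 := ih (by omega)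
    have h2 := B.a_anti σ x hσ (i := 2 * (m + d) + 1) (j := 2 * (m + (d + 1))) (by omega) (by omega)
    rw [Finset.sum_range_succ]
    have : m + (d + 1) = m + d + 1 := by omega
    rw [this] at h2 ⊢
    linarith

lemma BarcodeRep.ff_bar (B : BarcodeRep) (σ x : ℝ) (hσ : 0 < σ) {k : ℕ} (hk : k < B.n) :
    Phi σ (x - B.t (2 * k)) + Phi σ (B.t (2 * k + 1) - x) - 1 ≤ B.ff σ x := by
  have := Finset.single_le_sum (s := Finset.range B.n)
    (f := fun k => Phi σ (x - B.t (2 * k)) - Phi σ (x - B.t (2 * k + 1)))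
    (fun i hi => by
      rw [Finset.mem_range] at hi
      exact sub_nonneg.2 (B.a_anti σ x hσ (by omega) (by omega))) (Finset.mem_range.2 hk)
  have h2 := Phi_symm σ (x - B.t (2 * k + 1)) hσ
  rw [neg_sub] at h2
  unfold BarcodeRep.ff
  linarith

lemma BarcodeRep.ff_space (B : BarcodeRep) (σ x : ℝ) (hσ : 0 < σ) {k : ℕ} (hk : k + 1 < B.n) :
    B.ff σ x ≤ 1 - (Phi σ (x - B.t (2 * k + 1)) + Phi σ (B.t (2 * k + 2) - x) - 1) := by
  have h1 := B.tail σ x hσ 0 k (by omega)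
  obtain ⟨d, hd⟩ : ∃ d, B.n = k + 1 + d + 1 := ⟨B.n - (k + 1) - 1, by omega⟩
  have h2 := B.tail σ x hσ (k + 1) d hd.ge
  have h3 := Phi_symm σ (x - B.t (2 * k + 2)) hσ
  rw [neg_sub] at h3
  unfold BarcodeRep.ff
  rw [hd]
  simp only [Finset.range_zero, Finset.sum_empty, zero_add, mul_zero] at h1
  have h4 := Phi_le_one σ (x - B.t 0) hσ
  have h5 := Phi_nonneg σ (x - B.t (2 * (k + 1 + d) + 1)) hσ
  rw [show 2 * (k + 1) = 2 * k + 2 by ring] at h2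
  linarith

lemma BarcodeRep.ff_left (B : BarcodeRep) (σ x : ℝ) (hσ : 0 < σ) (h : B.n ≠ 0 → x < B.t 0) :
    B.ff σ x < 1 / 2 := by
  by_cases hn : B.n = 0
  · simp [BarcodeRep.ff, hn]
  obtain ⟨d, hd⟩ : ∃ d, B.n = 0 + d + 1 := ⟨B.n - 1, by omega⟩
  have h1 := B.tail σ x hσ 0 d hd.ge
  have h3 := Phi_symm σ (x - B.t 0) hσ
  rw [neg_sub] at h3
  have h2 := Phi_gt_half σ (B.t 0 - x) (by linarith [h hn]) hσ
  have h5 := Phi_nonneg σ (x - B.t (2 * (0 + d) + 1)) hσ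
  unfold BarcodeRep.ff
  rw [hd]
  rw [Finset.range_zero, Finset.sum_empty, mul_zero] at h1
  linarith

lemma BarcodeRep.ff_right (B : BarcodeRep) (σ x : ℝ) (hσ : 0 < σ) (hn : B.n ≠ 0)
    (h : B.t (2 * B.n - 1) < x) : B.ff σ x < 1 / 2 := by
  obtain ⟨d, hd⟩ : ∃ d, B.n = 0 + d + 1 := ⟨B.n - 1, by omega⟩
  have h1 := B.tail σ x hσ 0 d hd.ge
  have e : 2 * B.n - 1 = 2 * (0 + d) + 1 := by omega
  rw [e] at h
  have h2 := Phi_gt_half σ (x - B.t (2 * (0 + d) + 1)) (by linarith) hσ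
  have h5 := Phi_le_one σ (x - B.t 0) hσ
  unfold BarcodeRep.ff
  rw [hd]
  rw [Finset.range_zero, Finset.sum_empty, mul_zero] at h1
  linarith

/-- Calibration data: sign and mass conditions. -/
structure Good (B : BarcodeRep) (G : ℝ → ℝ) : Prop where
  cont : Continuous G
  bar : ∀ k < B.n, ∀ x ∈ Ioo (B.t (2 * k)) (B.t (2 * k + 1)), G x < 0
  barI : ∀ k < B.n, ∫ x in (B.t (2 * k))..(B.t (2 * k + 1)), G x < -2
  space : ∀ k, k + 1 < B.n → ∀ x ∈ Ioo (B.t (2 * k + 1)) (B.t (2 * k + 2)), 0 < G x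
  spaceI : ∀ k, k + 1 < B.n → 2 < ∫ x in (B.t (2 * k + 1))..(B.t (2 * k + 2)), G x
  left : ∀ x, (B.n ≠ 0 → x < B.t 0) → 0 < G x
  right : ∀ x, B.n ≠ 0 → B.t (2 * B.n - 1) < x → 0 < G x

lemma good_of (B : BarcodeRep) (σ ω lam : ℝ) (hσ : 0 < σ) (hB : B.MinWidth ω) (hlam : 0 < lam)
    (h₁ : σ ≤ ω) (h₂ : 2/3 * σ + 2 / lam < ω) : Good B (fun x => lam * (1 - 2 * B.ff σ x)) := by
  have c := B.ff_cont σ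
  have c' := Phi_cont σ
  have hl : ∀ L, ω ≤ L → 2 < lam * (L - 2 / 3 * σ) := by
    intro L hL
    have : 2 / lam < L - 2 / 3 * σ := by linarith
    rwa [div_lt_iff₀' hlam] at this
  refine ⟨by fun_prop, ?_, ?_, ?_, ?_, ?_, ?_⟩
  · intro k hk x hx
    have h := B.ff_bar σ x hσ hk
    have h2 := Phi_pair σ (x - B.t (2 * k)) (B.t (2 * k + 1) - x) (by linarith [hx.1])
      (by linarith [hx.2]) (by linarith [hB.1 k hk]) hσ
    exact mul_neg_of_pos_of_neg hlam (by linarith)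
  · intro k hk
    have hw := hB.1 k hk
    have h := Phi_int2 σ (B.t (2 * k)) (B.t (2 * k + 1)) (by linarith) hσ
    have h3 : ∫ x in (B.t (2 * k))..(B.t (2 * k + 1)),
        (2 * (Phi σ (x - B.t (2 * k)) + Phi σ (B.t (2 * k + 1) - x) - 1) - 1) ≤
        ∫ x in (B.t (2 * k))..(B.t (2 * k + 1)), -(1 - 2 * B.ff σ x) := by
      apply intervalIntegral.integral_mono_on (by linarith)
      · apply Continuous.intervalIntegrable; fun_prop
      · apply Continuous.intervalIntegrable; fun_prop
      · intro x _
        linarith [B.ff_bar σ x hσ hk]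
    rw [intervalIntegral.integral_neg, h] at h3
    rw [intervalIntegral.integral_const_mul]
    nlinarith [hl _ hw]
  · intro k hk x hx
    have h := B.ff_space σ x hσ hk
    have h2 := Phi_pair σ (x - B.t (2 * k + 1)) (B.t (2 * k + 2) - x) (by linarith [hx.1])
      (by linarith [hx.2]) (by linarith [hB.2.1 k hk]) hσ
    exact mul_pos hlam (by linarith)
  · intro k hk
    have hw := hB.2.1 k hk
    have h := Phi_int2 σ (B.t (2 * k + 1)) (B.t (2 * k + 2)) (by linarith) hσ
    have h3 : ∫ x in (B.t (2 * k + 1))..(B.t (2 * k + 2)),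
        (2 * (Phi σ (x - B.t (2 * k + 1)) + Phi σ (B.t (2 * k + 2) - x) - 1) - 1) ≤
        ∫ x in (B.t (2 * k + 1))..(B.t (2 * k + 2)), (1 - 2 * B.ff σ x) := by
      apply intervalIntegral.integral_mono_on (by linarith)
      · apply Continuous.intervalIntegrable; fun_prop
      · apply Continuous.intervalIntegrable; fun_prop
      · intro x _
        linarith [B.ff_space σ x hσ hk]
    rw [h] at h3
    rw [intervalIntegral.integral_const_mul]
    nlinarith [hl _ hw]
  · intro x hx
    exact mul_pos hlam (by linarith [B.ff_left σ x hσ hx])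
  · intro x hn hx
    exact mul_pos hlam (by linarith [B.ff_right σ x hσ hn hx])

def thet (B : BarcodeRep) (G : ℝ → ℝ) (k : ℕ) : ℝ := 2 / |∫ x in (B.t k)..(B.t (k + 1)), G x|

def hh (B : BarcodeRep) (G : ℝ → ℝ) (x : ℝ) : ℝ :=
  ∑ k ∈ Finset.range (2 * B.n - 1), (Ioc (B.t k) (B.t (k + 1))).indicator (fun x => thet B G k * G x) x

lemma hh_on (B : BarcodeRep) (G : ℝ → ℝ) {k : ℕ} (hk : k + 1 < 2 * B.n) {x : ℝ}
    (hx : x ∈ Ioc (B.t k) (B.t (k + 1))) : hh B G x = thet B G k * G x := by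
  unfold hh
  rw [Finset.sum_eq_single k]
  · rw [indicator_of_mem hx]
  · intro j hj hjk
    rw [Finset.mem_range] at hj
    apply indicator_of_notMem
    rintro ⟨h1, h2⟩
    rcases lt_or_gt_of_ne hjk with h | h
    · have := B.le (i := j + 1) (j := k) (by omega) (by omega)
      linarith [hx.1]
    · have := B.le (i := k + 1) (j := j) (by omega) (by omega)
      linarith [hx.2]
  · intro h
    exact absurd (Finset.mem_range.2 (by omega)) h

lemma hh_left (B : BarcodeRep) (G : ℝ → ℝ) {x : ℝ} (h : B.n ≠ 0 → x ≤ B.t 0) : hh B G x = 0 := by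
  apply Finset.sum_eq_zero
  intro k hk
  rw [Finset.mem_range] at hk
  apply indicator_of_notMem
  rintro ⟨h1, h2⟩
  have := B.le (i := 0) (j := k) (by omega) (by omega)
  linarith [h (by omega)]

lemma hh_right (B : BarcodeRep) (G : ℝ → ℝ) {x : ℝ} (h : B.t (2 * B.n - 1) < x) :
    hh B G x = 0 := by
  apply Finset.sum_eq_zero
  intro k hk
  rw [Finset.mem_range] at hk
  apply indicator_of_notMem
  rintro ⟨h1, h2⟩
  have := B.le (i := k + 1) (j := 2 * B.n - 1) (by omega) (by omega)
  linarith

lemma hh_int (B : BarcodeRep) {G : ℝ → ℝ} (hG : Continuous G) : Integrable (hh B G) := by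
  unfold hh
  apply integrable_finsetSum
  intro k _
  rw [integrable_indicator_iff measurableSet_Ioc]
  have : Continuous fun x => thet B G k * G x := by fun_prop
  exact this.continuousOn.integrableOn_Icc.mono_set Ioc_subset_Icc_self

lemma hh_piece (B : BarcodeRep) (G : ℝ → ℝ) {k : ℕ} (hk : k + 1 < 2 * B.n) {a b : ℝ}
    (ha : B.t k ≤ a) (hab : a ≤ b) (hb : b ≤ B.t (k + 1)) :
    ∫ y in a..b, hh B G y = thet B G k * ∫ y in a..b, G y := by
  rw [← intervalIntegral.integral_const_mul, intervalIntegral.integral_of_le hab,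
    intervalIntegral.integral_of_le hab]
  apply setIntegral_congr_fun measurableSet_Ioc
  intro y hy
  exact hh_on B G hk ⟨ha.trans_lt hy.1, hy.2.trans hb⟩

lemma thet_bar {B : BarcodeRep} {G : ℝ → ℝ} (g : Good B G) {k : ℕ} (hk : k < B.n) :
    0 < thet B G (2 * k) ∧ thet B G (2 * k) < 1 ∧
    thet B G (2 * k) * ∫ x in (B.t (2 * k))..(B.t (2 * k + 1)), G x = -2 := by
  have h := g.barI k hk
  unfold thet
  set I := ∫ x in (B.t (2 * k))..(B.t (2 * k + 1)), G x
  rw [abs_of_neg (by linarith)]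
  refine ⟨div_pos two_pos (by linarith), ?_, ?_⟩
  · rw [div_lt_one (by linarith)]; linarith
  · have : I ≠ 0 := by linarith
    field_simp

lemma thet_space {B : BarcodeRep} {G : ℝ → ℝ} (g : Good B G) {k : ℕ} (hk : k + 1 < B.n) :
    0 < thet B G (2 * k + 1) ∧ thet B G (2 * k + 1) < 1 ∧
    thet B G (2 * k + 1) * ∫ x in (B.t (2 * k + 1))..(B.t (2 * k + 2)), G x = 2 := by
  have h := g.spaceI k hk
  unfold thet
  rw [show 2 * k + 1 + 1 = 2 * k + 2 by ring]
  set I := ∫ x in (B.t (2 * k + 1))..(B.t (2 * k + 2)), G x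
  rw [abs_of_pos (by linarith)]
  refine ⟨div_pos two_pos (by linarith), ?_, ?_⟩
  · rw [div_lt_one (by linarith)]; linarith
  · have : I ≠ 0 := by linarith
    field_simp

lemma int_bar_nonpos {B : BarcodeRep} {G : ℝ → ℝ} (g : Good B G) {k : ℕ} (hk : k < B.n) {a b : ℝ}
    (ha : B.t (2 * k) ≤ a) (hab : a ≤ b) (hb : b ≤ B.t (2 * k + 1)) :
    ∫ y in a..b, hh B G y ≤ 0 := by
  rw [hh_piece B G (by omega) ha hab hb]
  apply mul_nonpos_of_nonneg_of_nonpos (thet_bar g hk).1.le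
  have := intervalIntegral.integral_mono_on_of_le_Ioo hab (g.cont.intervalIntegrable (μ := volume) a b)
    ((continuous_const (y := (0:ℝ))).intervalIntegrable a b)
    (fun x hx => (g.bar k hk x ⟨ha.trans_lt hx.1, hx.2.trans_le hb⟩).le)
  simpa using this

lemma int_space_nonneg {B : BarcodeRep} {G : ℝ → ℝ} (g : Good B G) {k : ℕ} (hk : k + 1 < B.n)
    {a b : ℝ} (ha : B.t (2 * k + 1) ≤ a) (hab : a ≤ b) (hb : b ≤ B.t (2 * k + 2)) :
    0 ≤ ∫ y in a..b, hh B G y := by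
  rw [hh_piece B G (by omega) ha hab hb]
  apply mul_nonneg (thet_space g hk).1.le
  have := intervalIntegral.integral_mono_on_of_le_Ioo hab
    ((continuous_const (y := (0:ℝ))).intervalIntegrable a b)
    (g.cont.intervalIntegrable (μ := volume) a b)
    (fun x hx => (g.space k hk x ⟨ha.trans_lt hx.1, hx.2.trans_le hb⟩).le)
  simpa using this

lemma int_bar_full {B : BarcodeRep} {G : ℝ → ℝ} (g : Good B G) {k : ℕ} (hk : k < B.n) :
    ∫ y in (B.t (2 * k))..(B.t (2 * k + 1)), hh B G y = -2 := by
  rw [hh_piece B G (by omega) le_rfl (B.le (by omega) (by omega)) le_rfl, (thet_bar g hk).2.2]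

lemma int_space_full {B : BarcodeRep} {G : ℝ → ℝ} (g : Good B G) {k : ℕ} (hk : k + 1 < B.n) :
    ∫ y in (B.t (2 * k + 1))..(B.t (2 * k + 2)), hh B G y = 2 := by
  rw [hh_piece B G (by omega) le_rfl (B.le (by omega) (by omega)) le_rfl, (thet_space g hk).2.2]

lemma xi_bar {B : BarcodeRep} {G : ℝ → ℝ} (g : Good B G) {k : ℕ} (hk : k < B.n) {a x : ℝ}
    (h0 : ∫ y in a..(B.t (2 * k)), hh B G y = 0)
    (hx : B.t (2 * k) ≤ x) (hx' : x ≤ B.t (2 * k + 1)) :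
    (∫ y in a..x, hh B G y) ∈ Icc (-2:ℝ) 0 ∧ ∫ y in a..(B.t (2 * k + 1)), hh B G y = -2 := by
  have i : ∀ a b, IntervalIntegrable (hh B G) volume a b :=
    fun a b => (hh_int B g.cont).intervalIntegrable
  have e1 := intervalIntegral.integral_add_adjacent_intervals (i a (B.t (2 * k))) (i _ x)
  have e2 := intervalIntegral.integral_add_adjacent_intervals (i a (B.t (2 * k))) (i _ (B.t (2 * k + 1)))
  have e3 := intervalIntegral.integral_add_adjacent_intervals (i (B.t (2 * k)) x) (i _ (B.t (2 * k + 1)))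
  have e4 := int_bar_nonpos g hk le_rfl hx hx'
  have e5 := int_bar_nonpos g hk hx hx' le_rfl
  have e6 := int_bar_full g hk
  exact ⟨⟨by linarith, by linarith⟩, by linarith⟩

lemma xi_space {B : BarcodeRep} {G : ℝ → ℝ} (g : Good B G) {k : ℕ} (hk : k + 1 < B.n) {a x : ℝ}
    (h0 : ∫ y in a..(B.t (2 * k + 1)), hh B G y = -2)
    (hx : B.t (2 * k + 1) ≤ x) (hx' : x ≤ B.t (2 * k + 2)) :
    (∫ y in a..x, hh B G y) ∈ Icc (-2:ℝ) 0 ∧ ∫ y in a..(B.t (2 * k + 2)), hh B G y = 0 := by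
  have i : ∀ a b, IntervalIntegrable (hh B G) volume a b :=
    fun a b => (hh_int B g.cont).intervalIntegrable
  have e1 := intervalIntegral.integral_add_adjacent_intervals (i a (B.t (2 * k + 1))) (i _ x)
  have e2 := intervalIntegral.integral_add_adjacent_intervals (i a (B.t (2 * k + 1))) (i _ (B.t (2 * k + 2)))
  have e3 := intervalIntegral.integral_add_adjacent_intervals (i (B.t (2 * k + 1)) x) (i _ (B.t (2 * k + 2)))
  have e4 := int_space_nonneg g hk le_rfl hx hx'
  have e5 := int_space_nonneg g hk hx hx' le_rfl
  have e6 := int_space_full g hk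
  exact ⟨⟨by linarith, by linarith⟩, by linarith⟩

lemma xi_main {B : BarcodeRep} {G : ℝ → ℝ} (g : Good B G) (k : ℕ) (hk : k < B.n) :
    (∫ y in (B.t 0)..(B.t (2 * k + 1)), hh B G y = -2) ∧
    ∀ x, B.t 0 ≤ x → x ≤ B.t (2 * k + 1) → (∫ y in (B.t 0)..x, hh B G y) ∈ Icc (-2:ℝ) 0 := by
  induction k with
  | zero =>
    have h0 : ∫ y in (B.t 0)..(B.t (2 * 0)), hh B G y = 0 := by simp
    exact ⟨(xi_bar g hk h0 le_rfl (B.le (by omega) (by omega))).2,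
      fun x hx hx' => (xi_bar g hk h0 hx hx').1⟩
  | succ k ih =>
    obtain ⟨h1, h2⟩ := ih (by omega)
    have h3 := (xi_space g hk h1 le_rfl (B.le (by omega) (by omega))).2
    have h4 := fun x => xi_bar (k := k + 1) (x := x) g hk h3
    refine ⟨(h4 _ le_rfl (B.le (by omega) (by omega))).2, fun x hx hx' => ?_⟩
    rcases le_total x (B.t (2 * k + 1)) with h | h
    · exact h2 x hx h
    rcases le_total x (B.t (2 * k + 2)) with h' | h'
    · exact (xi_space g hk h1 h h').1
    · exact (h4 x h' hx').1

lemma xi_all {B : BarcodeRep} {G : ℝ → ℝ} (g : Good B G) (x : ℝ) :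
    (∫ y in (B.t 0)..x, hh B G y) ∈ Icc (-2:ℝ) 0 := by
  by_cases hn : B.n = 0
  · have : ∀ y, hh B G y = 0 := fun y => hh_left B G (by simp [hn])
    simp [this]
  have e : 2 * (B.n - 1) + 1 = 2 * B.n - 1 := by omega
  have h := xi_main g (B.n - 1) (by omega)
  rw [e] at h
  rcases le_total x (B.t 0) with hx | hx
  · rw [intervalIntegral.integral_symm, intervalIntegral.integral_of_le hx,
      setIntegral_congr_fun (g := fun _ => 0) measurableSet_Ioc
        (fun y hy => hh_left B G (fun _ => hy.2))]
    simp
  rcases le_total x (B.t (2 * B.n - 1)) with hx' | hx'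
  · exact h.2 x hx hx'
  · have i : ∀ a b, IntervalIntegrable (hh B G) volume a b :=
      fun a b => (hh_int B g.cont).intervalIntegrable
    rw [← intervalIntegral.integral_add_adjacent_intervals (i _ (B.t (2 * B.n - 1))) (i _ x), h.1,
      intervalIntegral.integral_of_le hx',
      setIntegral_congr_fun (g := fun _ => 0) measurableSet_Ioc
        (fun y hy => hh_right B G hy.1)]
    simp

lemma hh_osc {B : BarcodeRep} {G : ℝ → ℝ} (g : Good B G) (a b : ℝ) :
    -2 ≤ ∫ y in a..b, hh B G y := by
  have i : ∀ a b, IntervalIntegrable (hh B G) volume a b :=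
    fun a b => (hh_int B g.cont).intervalIntegrable
  have := intervalIntegral.integral_add_adjacent_intervals (i (B.t 0) a) (i _ b)
  linarith [(xi_all g a).2, (xi_all g b).1]

lemma fn_mul (C : BarcodeRep) (g : ℝ → ℝ) (x : ℝ) : C.fn x * g x = ∑ k ∈ Finset.range C.n,
    (Icc (C.t (2 * k)) (C.t (2 * k + 1))).indicator g x := by
  rw [C.fn_sum, Finset.sum_mul]
  apply Finset.sum_congr rfl
  intro k _
  by_cases h : x ∈ Icc (C.t (2 * k)) (C.t (2 * k + 1)) <;> simp [h]

lemma fn_mul_int (C : BarcodeRep) (g : ℝ → ℝ) (hg : LocallyIntegrable g) :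
    Integrable (fun x => C.fn x * g x) ∧
    ∫ x, C.fn x * g x = ∑ k ∈ Finset.range C.n, ∫ x in (C.t (2 * k))..(C.t (2 * k + 1)), g x := by
  simp_rw [fn_mul]
  have h : ∀ k ∈ Finset.range C.n,
      Integrable ((Icc (C.t (2 * k)) (C.t (2 * k + 1))).indicator g) := by
    intro k _
    rw [integrable_indicator_iff measurableSet_Icc]
    exact hg.integrableOn_isCompact isCompact_Icc
  refine ⟨integrable_finsetSum _ h, ?_⟩
  rw [integral_finsetSum _ h]
  apply Finset.sum_congr rfl
  intro k hk
  rw [Finset.mem_range] at hk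
  rw [integral_indicator measurableSet_Icc, integral_Icc_eq_integral_Ioc,
    intervalIntegral.integral_of_le (C.le (by omega) (by omega))]

lemma location (B : BarcodeRep) (x : ℝ) (hx : ∀ j < 2 * B.n, x ≠ B.t j) :
    (B.n ≠ 0 → x < B.t 0) ∨ (B.n ≠ 0 ∧ B.t (2 * B.n - 1) < x) ∨
    ∃ j, j + 1 < 2 * B.n ∧ x ∈ Ioo (B.t j) (B.t (j + 1)) := by
  by_cases hn : B.n = 0
  · left; intro h; exact absurd hn h
  have key : ∀ m, m < 2 * B.n → x < B.t 0 ∨ B.t m < x ∨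
      ∃ j, j + 1 < 2 * B.n ∧ x ∈ Ioo (B.t j) (B.t (j + 1)) := by
    intro m
    induction m with
    | zero =>
      intro h
      rcases lt_or_gt_of_ne (hx 0 h) with h | h
      · exact Or.inl h
      · exact Or.inr (Or.inl h)
    | succ m ih =>
      intro h
      rcases ih (by omega) with h1 | h1 | h1
      · exact Or.inl h1
      · rcases lt_or_gt_of_ne (hx (m + 1) h) with h2 | h2
        · exact Or.inr (Or.inr ⟨m, h, h1, h2⟩)
        · exact Or.inr (Or.inl h2)
      · exact Or.inr (Or.inr h1)
  rcases key (2 * B.n - 1) (by omega) with h | h | h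
  · exact Or.inl fun _ => h
  · exact Or.inr (Or.inl ⟨hn, h⟩)
  · exact Or.inr (Or.inr h)

lemma sign_main {B : BarcodeRep} {G : ℝ → ℝ} (g : Good B G) (x : ℝ)
    (hx : ∀ j < 2 * B.n, x ≠ B.t j) :
    (B.fn x = 0 ∧ hh B G x < G x) ∨ (B.fn x = 1 ∧ G x < hh B G x) := by
  rcases location B x hx with h | ⟨hn, h⟩ | ⟨j, hj, h⟩
  · left
    rw [hh_left B G (fun hn => (h hn).le)]
    exact ⟨B.fn_left h, g.left x h⟩
  · left
    rw [hh_right B G h]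
    exact ⟨B.fn_right (fun _ => h), g.right x hn h⟩
  · rw [hh_on B G hj ⟨h.1, h.2.le⟩]
    rcases Nat.even_or_odd' j with ⟨k, rfl | rfl⟩
    · right
      have h1 := thet_bar g (k := k) (by omega)
      have h2 := g.bar k (by omega) x h
      exact ⟨B.fn_one (by omega) h.1.le h.2.le, by nlinarith⟩
    · left
      have h1 := thet_space g (k := k) (by omega)
      have h2 := g.space k (by omega) x h
      exact ⟨B.fn_space (by omega) h.1 h.2, by nlinarith⟩

lemma calib {B : BarcodeRep} {G : ℝ → ℝ} (g : Good B G) (C : BarcodeRep)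
    (hne : ¬ C.fn =ᵐ[volume] B.fn) :
    2 * B.n + ∫ x, B.fn x * G x < 2 * C.n + ∫ x, C.fn x * G x := by
  have lG : LocallyIntegrable G := g.cont.locallyIntegrable
  have lh : LocallyIntegrable (hh B G) := (hh_int B g.cont).locallyIntegrable
  obtain ⟨i1, e1⟩ := fn_mul_int B _ lG
  obtain ⟨i2, e2⟩ := fn_mul_int B _ lh
  obtain ⟨i3, e3⟩ := fn_mul_int C _ lG
  obtain ⟨i4, e4⟩ := fn_mul_int C _ lh
  have b2 : ∫ x, B.fn x * hh B G x = -2 * B.n := by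
    rw [e2, Finset.sum_congr rfl (fun k hk => int_bar_full g (Finset.mem_range.1 hk))]
    simp; ring
  have b4 : -2 * C.n ≤ ∫ x, C.fn x * hh B G x := by
    rw [e4]
    have := Finset.sum_le_sum (s := Finset.range C.n)
      (fun k _ => hh_osc g (C.t (2 * k)) (C.t (2 * k + 1)))
    simp at this; linarith
  have hae : ∀ᵐ x : ℝ, ∀ j < 2 * B.n, x ≠ B.t j := by
    rw [ae_all_iff]
    intro j
    filter_upwards [compl_mem_ae_iff.2 (measure_singleton (μ := volume) (B.t j))] with x hx _
    exact hx
  have hD : Integrable (fun x => (C.fn x * G x - C.fn x * hh B G x) -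
      (B.fn x * G x - B.fn x * hh B G x)) := (i3.sub i4).sub (i1.sub i2)
  have hpos : ∀ x, (∀ j < 2 * B.n, x ≠ B.t j) → C.fn x ≠ B.fn x →
      0 < (C.fn x * G x - C.fn x * hh B G x) - (B.fn x * G x - B.fn x * hh B G x) := by
    intro x hx hu
    rcases sign_main g x hx with ⟨h1, h2⟩ | ⟨h1, h2⟩
    · rcases C.fn_01 x with h3 | h3
      · exact absurd (h3.trans h1.symm) hu
      · rw [h1, h3]; linarith
    · rcases C.fn_01 x with h3 | h3
      · rw [h1, h3]; linarith
      · exact absurd (h3.trans h1.symm) hu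
  have hp : 0 < ∫ x, ((C.fn x * G x - C.fn x * hh B G x) -
      (B.fn x * G x - B.fn x * hh B G x)) := by
    have hnn : 0 ≤ᵐ[volume] (fun x => (C.fn x * G x - C.fn x * hh B G x) -
      (B.fn x * G x - B.fn x * hh B G x)) := by
      filter_upwards [hae] with x hx
      by_cases hu : C.fn x = B.fn x
      · simp [hu]
      · exact (hpos x hx hu).le
    rcases (integral_nonneg_of_ae hnn).eq_or_lt with h | h
    · exfalso
      have h0 := (integral_eq_zero_iff_of_nonneg_ae hnn hD).1 h.symm
      apply hne
      filter_upwards [hae, h0] with x hx h1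
      by_contra hu
      exact (hpos x hx hu).ne' h1
    · exact h
  have j1 : Integrable (fun x => C.fn x * G x - C.fn x * hh B G x) := i3.sub i4
  have j2 : Integrable (fun x => B.fn x * G x - B.fn x * hh B G x) := i1.sub i2
  rw [integral_sub j1 j2, integral_sub i3 i4, integral_sub i1 i2] at hp
  linarith

lemma fid_eq (C : BarcodeRep) (f : ℝ → ℝ) (hf : Continuous f) (hs : HasCompactSupport f)
    (lam : ℝ) (hlam : 0 < lam) :
    0 ≤ ∫ x, (C.fn x - f x) ^ 2 ∧ fidelity C.fn f = ENNReal.ofReal (∫ x, (C.fn x - f x) ^ 2) ∧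
    lam * ∫ x, (C.fn x - f x) ^ 2 =
      (∫ x, C.fn x * (lam * (1 - 2 * f x))) + lam * ∫ x, f x ^ 2 := by
  have c : Continuous fun x => 1 - 2 * f x := by fun_prop
  have i1 := (fn_mul_int C (fun x => 1 - 2 * f x) c.locallyIntegrable).1
  have i2 : Integrable (fun x => f x ^ 2) := by
    apply Continuous.integrable_of_hasCompactSupport (by fun_prop)
    exact hs.comp_left (g := fun y : ℝ => y ^ 2) (by simp)
  have e : ∀ x, (C.fn x - f x) ^ 2 = C.fn x * (1 - 2 * f x) + f x ^ 2 := by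
    intro x
    rcases C.fn_01 x with h | h <;> rw [h] <;> ring
  refine ⟨integral_nonneg fun x => sq_nonneg _, ?_, ?_⟩
  · unfold fidelity
    rw [ofReal_integral_eq_lintegral_ofReal _ (Filter.Eventually.of_forall fun x => sq_nonneg _)]
    simp_rw [e]
    exact i1.add i2
  · simp_rw [e]
    rw [integral_add i1 i2, mul_add, ← integral_const_mul]
    congr 2
    ext x; ring

/-- Theorem 1, part 2: for the hat kernel `φ̂_σ`, `z ∈ ℬ_ω`,
`f_σ = φ̂_σ * z`, if `σ ≤ ω` and `(2/3)σ + 2/λ < ω` then `z` is the unique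
minimiser of `F₁` over `ℬ`. -/
theorem statement1 (σ ω lam : ℝ) (hσ : 0 < σ) (hω : 0 < ω) (z : ℝ → ℝ)
    (hz : IsBarcodeW z ω) (hlam : 0 < lam) (h₁ : σ ≤ ω) (h₂ : 2/3 * σ + 2 / lam < ω) :
    ∀ u : ℝ → ℝ, IsBarcode u → ¬ u =ᵐ[volume] z →
      F1 lam (conv (hatKernel σ) z) z < F1 lam (conv (hatKernel σ) z) u := by
  rintro u ⟨C, rfl⟩ hne
  obtain ⟨B, rfl, hB⟩ := hz
  rw [B.conv_eq σ hσ]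
  have g := good_of B σ ω lam hσ hB hlam h₁ h₂
  have key := calib g C hne
  obtain ⟨n1, f1, e1⟩ := fid_eq B (B.ff σ) (B.ff_cont σ) (B.ff_supp σ hσ) lam hlam
  obtain ⟨n2, f2, e2⟩ := fid_eq C (B.ff σ) (B.ff_cont σ) (B.ff_supp σ hσ) lam hlam
  unfold F1
  have cst : ∀ m : ℕ, (2 * m : ENNReal) = ENNReal.ofReal (2 * m) := by
    intro m
    rw [ENNReal.ofReal_mul (by norm_num), ENNReal.ofReal_natCast]; simp
  refine lt_of_le_of_lt (add_le_add B.TV_le le_rfl) (lt_of_lt_of_le ?_ (add_le_add C.le_TV le_rfl))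
  rw [f1, f2, cst, cst, ← ENNReal.ofReal_mul hlam.le, ← ENNReal.ofReal_mul hlam.le,
    ← ENNReal.ofReal_add (by positivity) (by positivity),
    ← ENNReal.ofReal_add (by positivity) (by positivity), e1, e2]
  rw [ENNReal.ofReal_lt_ofReal_iff_of_nonneg (by rw [← e1]; positivity)]
  linarith

end
end

section
/- Let φ_σ, φ_ρ ∈ 𝒦 with parameters σ > 0 and ρ > 0, let ω > 0, let z ∈ ℬ_ω be a generating bar code, set f_σ = φ_σ * z, and let λ > 0. Then u ≡ 0 is the unique minimiser of F₃(u) = ∫_ℝ |u′| + λ‖φ_ρ*u − f_σ‖²_{L²(ℝ)} over BV(ℝ) (with F₃(u) := ∞ when φ_ρ*u ∉ L²(ℝ); uniqueness meaning F₃(0) < F₃(h) for every h ∈ BV(ℝ) with h ≠ 0 a.e.) if and only if ‖φ_ρ*f_σ‖_* ≤ 1/(2λ). -/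
open MeasureTheory Set

noncomputable section

open Filter Topology

lemma bv_measurable {h : ℝ → ℝ} (hh : TV h < ⊤) : Measurable h := by
  have h1 : BoundedVariationOn h univ := hh.ne
  obtain ⟨p, q, hp, hq, rfl⟩ :=
    h1.locallyBoundedVariationOn.exists_monotoneOn_sub_monotoneOn
  exact (monotoneOn_univ.1 hp).measurable.sub (monotoneOn_univ.1 hq).measurable

lemma bv_bounded {h : ℝ → ℝ} (hh : TV h < ⊤) : ∃ C, ∀ x, ‖h x‖ ≤ C := by
  have h1 : BoundedVariationOn h univ := hh.ne
  refine ⟨(eVariationOn h univ).toReal + ‖h 0‖, fun x => ?_⟩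
  have h2 := h1.dist_le (mem_univ x) (mem_univ (0:ℝ))
  rw [dist_eq_norm] at h2
  have h3 : ‖h x‖ ≤ ‖h x - h 0‖ + ‖h 0‖ := by
    simpa using norm_add_le (h x - h 0) (h 0)
  linarith

lemma kernel_even {φ p : ℝ → ℝ} {σ : ℝ} (hφ : IsKernelWith φ p σ) (x y : ℝ) :
    φ (x - y) = φ (y - x) := by
  obtain ⟨_, _, _, _, _, h⟩ := hφ
  rw [h, h, abs_sub_comm]

lemma kernel_integral {φ p : ℝ → ℝ} {σ : ℝ} (hφ : IsKernelWith φ p σ) :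
    ∫ x, φ x = 1 := by
  obtain ⟨hσ, _, _, _, hi, h⟩ := hφ
  have e : φ = fun x => (fun t => if t ≤ σ then p t else 0) |x| := by
    funext x; exact h x
  rw [e, integral_comp_abs (f := fun t => if t ≤ σ then p t else 0)]
  have e2 : (fun t => if t ≤ σ then p t else 0) = (Iic σ).indicator p := by
    funext t; simp [indicator]
  rw [e2, setIntegral_indicator measurableSet_Iic, Ioi_inter_Iic,
    ← intervalIntegral.integral_of_le hσ.le, hi]
  norm_num

lemma conv_integrand_int {φ h : ℝ → ℝ} (hφ : Integrable φ) (hm : Measurable h) {C : ℝ}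
    (hC : ∀ x, ‖h x‖ ≤ C) (x : ℝ) : Integrable (fun y => φ (x - y) * h y) :=
  (hφ.comp_sub_left x).mul_bdd hm.aestronglyMeasurable (Eventually.of_forall hC)

lemma conv_bound {φ h : ℝ → ℝ} (hφ : Integrable φ) {C : ℝ}
    (hC : ∀ x, ‖h x‖ ≤ C) (x : ℝ) : ‖conv φ h x‖ ≤ (∫ y, ‖φ y‖) * C := by
  have h1 : ‖conv φ h x‖ ≤ ∫ y, ‖φ (x - y)‖ * C := by
    refine norm_integral_le_of_norm_le ((hφ.comp_sub_left x).norm.mul_const C) ?_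
    refine Eventually.of_forall fun y => ?_
    rw [norm_mul]
    exact mul_le_mul_of_nonneg_left (hC y) (norm_nonneg _)
  rw [integral_mul_const] at h1
  rwa [integral_sub_left_eq_self (fun y => ‖φ y‖)] at h1

lemma conv_aesm {φ h : ℝ → ℝ} (hφ : Integrable φ) (hm : AEStronglyMeasurable h) :
    AEStronglyMeasurable (conv φ h) := by
  have h1 := (hm.convolution_integrand (μ := volume) (ContinuousLinearMap.mul ℝ ℝ)
    hφ.aestronglyMeasurable).integral_prod_right'
  refine h1.congr (Eventually.of_forall fun x => ?_)
  simp [conv, mul_comm]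

lemma conv_integrable {φ h : ℝ → ℝ} (hφ : Integrable φ) (hi : Integrable h) :
    Integrable (conv φ h) := by
  have h1 := (hi.convolution_integrand (μ := volume) (ContinuousLinearMap.mul ℝ ℝ)
    hφ).integral_prod_left
  refine h1.congr (Eventually.of_forall fun x => ?_)
  simp [conv, mul_comm]

lemma conv_memLp {φ h : ℝ → ℝ} (hφ : Integrable φ) (hi : Integrable h) {C : ℝ}
    (hC : ∀ x, ‖h x‖ ≤ C) : MemLp (conv φ h) 2 := by
  have hc := conv_integrable hφ hi
  rw [memLp_two_iff_integrable_sq hc.aestronglyMeasurable]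
  have := hc.mul_bdd hc.aestronglyMeasurable (Eventually.of_forall (conv_bound hφ hC))
  simpa [pow_two] using this

lemma conv_adjoint {φ f h : ℝ → ℝ} (hφ : Integrable φ) (he : ∀ x y, φ (x - y) = φ (y - x))
    (hf : Integrable f) (hm : Measurable h) {C : ℝ} (hC : ∀ x, ‖h x‖ ≤ C) :
    ∫ x, conv φ h x * f x = ∫ y, conv φ f y * h y := by
  have h1 := (hf.convolution_integrand (μ := volume) (ContinuousLinearMap.mul ℝ ℝ) hφ)
  have h2 := h1.mul_bdd (g := fun q : ℝ × ℝ => h q.1) (c := C)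
    (hm.comp measurable_fst).aestronglyMeasurable (Eventually.of_forall fun q => hC q.1)
  have h3 := integral_integral_swap (f := fun x y => f y * φ (x - y) * h x) (by simpa [Function.uncurry_def] using h2)
  have e1 : ∀ x, conv φ h x * f x = ∫ y, f x * φ (y - x) * h y := by
    intro x
    rw [conv, ← integral_mul_const]
    congr 1; funext y; rw [he x y]; ring
  have e2 : ∀ x, conv φ f x * h x = ∫ y, f y * φ (x - y) * h x := by
    intro x
    rw [conv, ← integral_mul_const]
    congr 1; funext y; ring
  simp_rw [e1, e2]
  exact h3.symm

lemma conv_tendsto {φ h : ℝ → ℝ} (hφ : Integrable φ) (h1 : ∫ x, φ x = 1)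
    (hm : Measurable h) {C : ℝ} (hC : ∀ x, ‖h x‖ ≤ C) {l : Filter ℝ}
    [l.IsCountablyGenerated] (hl : ∀ y, Tendsto (fun x : ℝ => x - y) l l) {L : ℝ}
    (hL : Tendsto h l (𝓝 L)) : Tendsto (conv φ h) l (𝓝 L) := by
  have e : conv φ h = fun x => ∫ y, φ y * h (x - y) := by
    funext x
    rw [conv, ← integral_sub_left_eq_self (fun y => φ y * h (x - y)) volume x]
    simp
  have e2 : L = ∫ y, φ y * L := by rw [integral_mul_const, h1, one_mul]
  rw [e, e2]
  refine tendsto_integral_filter_of_dominated_convergence (fun y => ‖φ y‖ * C) ?_ ?_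
    (hφ.norm.mul_const C) ?_
  · refine Eventually.of_forall fun x => hφ.aestronglyMeasurable.mul ?_
    exact (hm.comp (measurable_const.sub measurable_id)).aestronglyMeasurable
  · refine Eventually.of_forall fun x => Eventually.of_forall fun y => ?_
    rw [norm_mul]
    exact mul_le_mul_of_nonneg_left (hC _) (norm_nonneg _)
  · refine Eventually.of_forall fun y => ?_
    exact (hL.comp (hl y)).const_mul _

lemma limit_zero {φ h : ℝ → ℝ} (hφ : Integrable φ) (h1 : ∫ x, φ x = 1)
    (hm : Measurable h) {C : ℝ} (hC : ∀ x, ‖h x‖ ≤ C) {l : Filter ℝ}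
    [l.IsCountablyGenerated] (hl : ∀ y, Tendsto (fun x : ℝ => x - y) l l)
    (hv : ∀ s ∈ l, volume s = ⊤) {L : ℝ}
    (hL : Tendsto h l (𝓝 L)) (h2 : MemLp (conv φ h) 2) : L = 0 := by
  have h3 := (conv_tendsto hφ h1 hm hC hl hL).pow 2
  have h4 : IntegrableAtFilter (fun x => conv φ h x ^ 2) l volume :=
    h2.integrable_sq.integrableAtFilter l
  have := h4.eq_zero_of_tendsto hv h3
  simpa using this

lemma vol_atTop : ∀ s ∈ (atTop : Filter ℝ), volume s = ⊤ := by
  intro s hs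
  obtain ⟨a, ha⟩ := mem_atTop_sets.1 hs
  have : Ici a ⊆ s := fun x hx => ha x hx
  exact top_unique (by simpa using measure_mono (μ := volume) this)

lemma vol_atBot : ∀ s ∈ (atBot : Filter ℝ), volume s = ⊤ := by
  intro s hs
  obtain ⟨a, ha⟩ := mem_atBot_sets.1 hs
  have : Iic a ⊆ s := fun x hx => ha x hx
  exact top_unique (by simpa using measure_mono (μ := volume) this)

/-- soft thresholding -/
def soft (ε x : ℝ) : ℝ := x - max (-ε) (min ε x)

lemma soft_lip (ε : ℝ) : LipschitzWith 1 (soft ε) := by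
  refine LipschitzWith.of_dist_le_mul fun x y => ?_
  simp only [Real.dist_eq, soft, NNReal.coe_one, one_mul]
  rcases max_cases (-ε) (min ε x) with h1 | h1 <;> rcases max_cases (-ε) (min ε y) with h2 | h2 <;>
  rcases min_cases ε x with h3 | h3 <;> rcases min_cases ε y with h4 | h4 <;>
  rw [abs_le] <;> constructor <;>
  rcases abs_cases (x - y) with h5 | h5 <;> linarith [h1.1, h2.1, h1.2, h2.2, h3.1, h3.2, h4.1, h4.2]

lemma soft_close {ε : ℝ} (hε : 0 < ε) (x : ℝ) : |x - soft ε x| ≤ ε := by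
  simp only [soft, sub_sub_cancel, abs_le]
  exact ⟨le_max_left _ _, max_le (by linarith) (min_le_left _ _)⟩

lemma soft_zero {ε x : ℝ} (h : |x| ≤ ε) : soft ε x = 0 := by
  rw [abs_le] at h
  simp [soft, min_eq_right h.2, max_eq_right h.1]

lemma TV_smul_le (t : ℝ) (v : ℝ → ℝ) : TV (fun x => t * v x) ≤ ENNReal.ofReal |t| * TV v := by
  have hl : LipschitzWith (Real.toNNReal |t|) (fun x : ℝ => t * x) := by
    refine LipschitzWith.of_dist_le_mul fun x y => ?_
    simp [Real.dist_eq, ← mul_sub, abs_mul]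
  exact (hl.lipschitzOnWith (s := univ)).comp_eVariationOn_le (g := v) (s := univ)
    (mapsTo_univ _ _)

lemma pair_le {g v : ℝ → ℝ} {K : ℝ} (hK : 0 ≤ K) (hg : starNorm g ≤ ENNReal.ofReal K)
    (hv : Integrable v) (hT : TV v < ⊤) : |∫ x, g x * v x| ≤ K * (TV v).toReal := by
  have key : ∀ T : ℝ, 0 < T → (TV v).toReal ≤ T → |∫ x, g x * v x| ≤ K * T := by
    intro T hT0 hTle
    have h1 : TV (fun x => T⁻¹ * v x) ≤ 1 := by
      refine (TV_smul_le T⁻¹ v).trans ?_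
      rw [abs_of_pos (inv_pos.2 hT0)]
      have e2 : TV v = ENNReal.ofReal (TV v).toReal :=
        (ENNReal.ofReal_toReal hT.ne).symm
      rw [e2, ← ENNReal.ofReal_mul (by positivity)]
      refine ENNReal.ofReal_le_one.2 ?_
      rw [inv_mul_le_iff₀ hT0]; linarith
    have h2 : ENNReal.ofReal |∫ x, g x * (T⁻¹ * v x)| ≤ ENNReal.ofReal K := by
      refine le_trans ?_ hg
      exact le_iSup₂_of_le (fun x => T⁻¹ * v x) ⟨hv.const_mul _, h1⟩ le_rfl
    rw [ENNReal.ofReal_le_ofReal_iff hK] at h2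
    have e : ∫ x, g x * (T⁻¹ * v x) = T⁻¹ * ∫ x, g x * v x := by
      rw [← integral_const_mul]; congr 1; funext x; ring
    rw [e, abs_mul, abs_of_pos (inv_pos.2 hT0), inv_mul_le_iff₀ hT0] at h2
    linarith
  refine le_of_forall_pos_le_add fun δ hδ => ?_
  have h0 : 0 ≤ (TV v).toReal := ENNReal.toReal_nonneg
  have := key ((TV v).toReal + δ / (K + 1)) (by positivity) (by
    have : 0 < δ / (K + 1) := by positivity
    linarith)
  have h3 : K * (δ / (K + 1)) ≤ δ := by
    rw [mul_div_assoc', div_le_iff₀ (by positivity)]; nlinarith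
  nlinarith

/-- The pairing estimate extends to BV functions vanishing at infinity. -/
lemma pair_le' {g h : ℝ → ℝ} {K : ℝ} (hK : 0 ≤ K) (hg : starNorm g ≤ ENNReal.ofReal K)
    (hgi : Integrable g) (hT : TV h < ⊤) (ht : Tendsto h atTop (𝓝 0))
    (hb : Tendsto h atBot (𝓝 0)) : |∫ x, g x * h x| ≤ K * (TV h).toReal := by
  obtain ⟨C, hC⟩ := bv_bounded hT
  have hm := bv_measurable hT
  have key : ∀ ε : ℝ, 0 < ε → |∫ x, g x * h x| ≤ K * (TV h).toReal + (∫ x, ‖g x‖) * ε := by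
    intro ε hε
    have hvT : TV (soft ε ∘ h) ≤ TV h := by
      have := ((soft_lip ε).lipschitzOnWith (s := univ)).comp_eVariationOn_le (g := h) (s := univ)
        (mapsTo_univ _ _)
      simpa [TV] using this
    have hvm : Measurable (soft ε ∘ h) := (soft_lip ε).continuous.measurable.comp hm
    obtain ⟨D, hD⟩ := bv_bounded (hvT.trans_lt hT)
    obtain ⟨a, ha⟩ := mem_atTop_sets.1 (ht.eventually (Metric.ball_mem_nhds 0 hε))
    obtain ⟨b, hb'⟩ := mem_atBot_sets.1 (hb.eventually (Metric.ball_mem_nhds 0 hε))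
    have hvi : Integrable (soft ε ∘ h) := by
      have h1 : IntegrableOn (soft ε ∘ h) (Icc b a) := by
        refine Measure.integrableOn_of_bounded (M := D) (by simp) hvm.aestronglyMeasurable ?_
        exact Eventually.of_forall hD
      rw [← integrableOn_iff_integrable_of_support_subset (s := Icc b a)]
      · exact h1
      · intro x hx
        by_contra hc
        refine hx (soft_zero ?_)
        rw [mem_Icc, not_and_or, not_le, not_le] at hc
        rcases hc with hc | hc
        · have := hb' x hc.le; simp at this; exact this.le
        · have := ha x hc.le; simp at this; exact this.le
    have h1 := pair_le hK hg hvi (hvT.trans_lt hT)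
    have i1 : Integrable (fun x => g x * h x) :=
      hgi.mul_bdd hm.aestronglyMeasurable (Eventually.of_forall hC)
    have i2 : Integrable (fun x => g x * (soft ε ∘ h) x) :=
      hgi.mul_bdd hvm.aestronglyMeasurable (Eventually.of_forall hD)
    have h2 : |(∫ x, g x * h x) - ∫ x, g x * (soft ε ∘ h) x| ≤ (∫ x, ‖g x‖) * ε := by
      rw [← integral_sub i1 i2, ← integral_mul_const, ← Real.norm_eq_abs]
      refine norm_integral_le_of_norm_le (hgi.norm.mul_const ε) (Eventually.of_forall fun x => ?_)
      rw [← mul_sub, norm_mul]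
      exact mul_le_mul_of_nonneg_left (soft_close hε _) (norm_nonneg _)
    have h3 : K * (TV (soft ε ∘ h)).toReal ≤ K * (TV h).toReal :=
      mul_le_mul_of_nonneg_left (ENNReal.toReal_mono hT.ne hvT) hK
    have h4 := abs_sub_abs_le_abs_sub (∫ x, g x * h x) (∫ x, g x * (soft ε ∘ h) x)
    linarith
  refine le_of_forall_pos_le_add fun δ hδ => ?_
  have hG : 0 ≤ ∫ x, ‖g x‖ := integral_nonneg fun _ => norm_nonneg _
  have := key (δ / ((∫ x, ‖g x‖) + 1)) (by positivity)
  have h3 : (∫ x, ‖g x‖) * (δ / ((∫ x, ‖g x‖) + 1)) ≤ δ := by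
    rw [mul_div_assoc', div_le_iff₀ (by positivity)]; nlinarith
  linarith

lemma fidelity_eq {c f : ℝ → ℝ} (hc : MemLp c 2) (hf : MemLp f 2) :
    fidelity c f = ENNReal.ofReal ((∫ x, c x ^ 2) - 2 * (∫ x, c x * f x) + ∫ x, f x ^ 2) := by
  have h1 : Integrable (fun x => (c x - f x) ^ 2) := (hc.sub hf).integrable_sq
  have h2 : Integrable (fun x => c x * f x) := hc.integrable_mul hf
  rw [fidelity, ← ofReal_integral_eq_lintegral_ofReal h1
    (Eventually.of_forall fun x => sq_nonneg _)]
  congr 1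
  rw [← integral_const_mul, ← integral_sub hc.integrable_sq (h2.const_mul 2),
    ← integral_add (f := fun x => c x ^ 2 - 2 * (c x * f x))
      (hc.integrable_sq.sub (h2.const_mul 2)) hf.integrable_sq]
  congr 1; funext x; ring

lemma Fker_zero {lam : ℝ} {φ f : ℝ → ℝ} (hlam : 0 < lam) (hf : MemLp f 2) :
    Fker lam φ f (fun _ => (0:ℝ)) = ENNReal.ofReal (lam * ∫ x, f x ^ 2) := by
  have h1 : TV (fun _ => (0:ℝ)) = 0 := eVariationOn.constant_on (by
    rintro _ ⟨x, _, rfl⟩ _ ⟨y, _, rfl⟩; rfl)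
  have h2 : conv φ (fun _ => (0:ℝ)) = fun _ => 0 := by funext x; simp [conv]
  have h3 : MemLp (fun _ : ℝ => (0:ℝ)) 2 := MemLp.zero
  rw [Fker, h1, h2, fidelity_eq h3 hf, ← ENNReal.ofReal_mul hlam.le]
  simp

lemma Fker_lt {lam : ℝ} {φ f h : ℝ → ℝ} (hlam : 0 < lam) (hf : MemLp f 2)
    (hc : MemLp (conv φ h) 2) (hT : TV h < ⊤) :
    Fker lam φ f (fun _ => (0:ℝ)) < Fker lam φ f h ↔
      0 < (TV h).toReal + lam * (∫ x, conv φ h x ^ 2) - 2 * lam * ∫ x, conv φ h x * f x := by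
  have hnn : 0 ≤ (∫ x, conv φ h x ^ 2) - 2 * (∫ x, conv φ h x * f x) + ∫ x, f x ^ 2 := by
    have h1 : 0 ≤ ∫ x, (conv φ h x - f x) ^ 2 := integral_nonneg fun _ => sq_nonneg _
    have h2 : Integrable (fun x => conv φ h x * f x) := hc.integrable_mul hf
    convert h1 using 1
    rw [← integral_const_mul, ← integral_sub hc.integrable_sq (h2.const_mul 2),
      ← integral_add (f := fun x => conv φ h x ^ 2 - 2 * (conv φ h x * f x))
        (hc.integrable_sq.sub (h2.const_mul 2)) hf.integrable_sq]
    congr 1; funext x; ring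
  have hf0 : 0 ≤ ∫ x, f x ^ 2 := integral_nonneg fun _ => sq_nonneg _
  rw [Fker_zero hlam hf, Fker, fidelity_eq hc hf, ← ENNReal.ofReal_mul hlam.le]
  nth_rewrite 1 [← ENNReal.ofReal_toReal hT.ne]
  rw [← ENNReal.ofReal_add ENNReal.toReal_nonneg (by positivity),
    ENNReal.ofReal_lt_ofReal_iff_of_nonneg (by positivity)]
  constructor <;> intro h <;> nlinarith

lemma barcode_props {z : ℝ → ℝ} {ω : ℝ} (hz : IsBarcodeW z ω) :
    Integrable z ∧ ∀ x, ‖z x‖ ≤ 1 := by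
  obtain ⟨B, rfl, -⟩ := hz
  have hm : MeasurableSet B.supp :=
    Finset.measurableSet_biUnion _ fun k _ => measurableSet_Icc
  have hf : volume B.supp < ⊤ := by
    refine (measure_biUnion_finset_le _ _).trans_lt ?_
    exact ENNReal.sum_lt_top.2 fun k _ => by simp
  constructor
  · rw [BarcodeRep.fn, integrable_indicator_iff hm]
    exact integrableOn_const hf.ne
  · intro x
    by_cases hx : x ∈ B.supp <;> simp [BarcodeRep.fn, hx]

lemma real_aux {lam A P : ℝ} (hlam : 0 < lam) (hA : 0 ≤ A)
    (H : ∀ t : ℝ, t ≠ 0 → 0 < |t| + lam * (t ^ 2 * A) - 2 * lam * (t * P)) :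
    |P| ≤ 1 / (2 * lam) := by
  have key : ∀ δ : ℝ, 0 < δ → 2 * lam * |P| ≤ 1 + δ := by
    intro δ hδ
    set s := δ / (lam * A + 1) with hs
    have hs0 : 0 < s := by positivity
    have h1 : lam * A * s ≤ δ := by
      rw [hs, mul_div_assoc', div_le_iff₀ (by positivity)]
      nlinarith [mul_nonneg hlam.le hA]
    have h2 : 0 < s + lam * (s ^ 2 * A) - 2 * lam * (s * |P|) := by
      rcases abs_cases P with hP | hP
      · have := H s hs0.ne'
        rw [abs_of_pos hs0] at this
        rw [hP.1]; exact this
      · have := H (-s) (by linarith)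
        rw [abs_neg, abs_of_pos hs0] at this
        rw [hP.1]; nlinarith
    have h3 : 0 < s * (1 + lam * A * s - 2 * lam * |P|) := by nlinarith
    have := pos_of_mul_pos_right h3 hs0.le
    linarith
  have := le_of_forall_pos_le_add key
  rw [le_div_iff₀ (by positivity)]
  linarith


/-- Theorem 2, part 1: for `φ_σ, φ_ρ ∈ 𝒦`, `z ∈ ℬ_ω`,
`f_σ = φ_σ * z` and `λ > 0`, the zero function is the unique minimiser of `F₃`
over `BV(ℝ)` if and only if `‖φ_ρ * f_σ‖_* ≤ 1/(2λ)`. -/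
theorem statement2 (φσ pσ φρ pρ : ℝ → ℝ) (σ ρ ω lam : ℝ)
    (hφσ : IsKernelWith φσ pσ σ) (hφρ : IsKernelWith φρ pρ ρ) (hω : 0 < ω)
    (z : ℝ → ℝ) (hz : IsBarcodeW z ω) (hlam : 0 < lam) :
    (∀ h : ℝ → ℝ, TV h < ⊤ → ¬ h =ᵐ[volume] (fun _ => (0:ℝ)) →
        Fker lam φρ (conv φσ z) (fun _ => (0:ℝ)) < Fker lam φρ (conv φσ z) h) ↔
      starNorm (conv φρ (conv φσ z)) ≤ ENNReal.ofReal (1 / (2 * lam)) := by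
  have hev := kernel_even hφρ
  have hone := kernel_integral hφρ
  have hφ : Integrable φρ := hφρ.2.1
  obtain ⟨hzi, hzb⟩ := barcode_props hz
  have hfi : Integrable (conv φσ z) := conv_integrable hφσ.2.1 hzi
  have hf2 : MemLp (conv φσ z) 2 := conv_memLp hφσ.2.1 hzi hzb
  set f := conv φσ z with hfdef
  clear_value f
  have hgi : Integrable (conv φρ f) := conv_integrable hφ hfi
  constructor
  · intro H
    refine iSup₂_le fun v hv => ?_
    obtain ⟨hvi, hvT⟩ := hv
    refine ENNReal.ofReal_le_ofReal ?_
    have hvT' : TV v < ⊤ := hvT.trans_lt ENNReal.one_lt_top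
    by_cases hv0 : v =ᵐ[volume] (fun _ => (0:ℝ))
    · have : ∫ x, conv φρ f x * v x = 0 := by
        refine integral_eq_zero_of_ae ?_
        filter_upwards [hv0] with x hx
        simp [hx]
      rw [this, abs_zero]; positivity
    obtain ⟨C, hC⟩ := bv_bounded hvT'
    have hm := bv_measurable hvT'
    have hc := conv_memLp hφ hvi hC
    refine real_aux (A := ∫ x, conv φρ v x ^ 2) hlam (integral_nonneg fun _ => sq_nonneg _) ?_
    intro t ht
    have hTt := TV_smul_le t v
    have hTt' : TV (fun x => t * v x) < ⊤ :=
      hTt.trans_lt (ENNReal.mul_lt_top ENNReal.ofReal_lt_top hvT')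
    have hct : conv φρ (fun x => t * v x) = fun x => t * conv φρ v x := by
      funext x
      simp only [conv]
      rw [← integral_const_mul]
      congr 1; funext y; ring
    have h1 := H (fun x => t * v x) hTt' (by
      intro h0
      refine hv0 ?_
      filter_upwards [h0] with x hx
      exact (mul_eq_zero.1 hx).resolve_left ht)
    rw [Fker_lt hlam hf2 (by rw [hct]; exact hc.const_mul t) hTt', hct] at h1
    have h2 : (TV (fun x => t * v x)).toReal ≤ |t| := by
      refine ENNReal.toReal_le_of_le_ofReal (abs_nonneg t) (hTt.trans ?_)
      calc ENNReal.ofReal |t| * TV v ≤ ENNReal.ofReal |t| * 1 := by gcongr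
        _ = _ := mul_one _
    have e1 : ∫ x, (t * conv φρ v x) ^ 2 = t ^ 2 * ∫ x, conv φρ v x ^ 2 := by
      rw [← integral_const_mul]; congr 1; funext x; ring
    have e2 : ∫ x, t * conv φρ v x * f x = t * ∫ x, conv φρ f x * v x := by
      rw [← conv_adjoint hφ hev hfi hm hC, ← integral_const_mul]
      congr 1; funext x; ring
    simp only [e1, e2] at h1
    linarith
  · intro hstar h hT hne
    by_cases hfin : fidelity (conv φρ h) f = ⊤
    · rw [Fker_zero hlam hf2, Fker, hfin, ENNReal.mul_top (by simpa using hlam)]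
      simp
    obtain ⟨C, hC⟩ := bv_bounded hT
    have hm := bv_measurable hT
    have hcm : AEStronglyMeasurable (conv φρ h) := conv_aesm hφ hm.aestronglyMeasurable
    have hd : MemLp (conv φρ h - f) 2 := by
      rw [memLp_two_iff_integrable_sq (hcm.sub hfi.aestronglyMeasurable)]
      refine ⟨(hcm.sub hfi.aestronglyMeasurable).pow 2, ?_⟩
      rw [hasFiniteIntegral_iff_ofReal (Eventually.of_forall fun x => sq_nonneg _)]
      exact lt_top_iff_ne_top.2 hfin
    have hc : MemLp (conv φρ h) 2 := by simpa using hd.add hf2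
    rw [Fker_lt hlam hf2 hc hT, conv_adjoint hφ hev hfi hm hC]
    have hbv : BoundedVariationOn h univ := hT.ne
    obtain ⟨L1, hL1⟩ := hbv.exists_tendsto_atTop
    obtain ⟨L2, hL2⟩ := hbv.exists_tendsto_atBot
    rw [Filter.principal_univ, top_inf_eq] at hL1 hL2
    have z1 : L1 = 0 := limit_zero hφ hone hm hC
      (fun y => tendsto_atTop_add_const_right _ (-y) tendsto_id) vol_atTop hL1 hc
    have z2 : L2 = 0 := limit_zero hφ hone hm hC
      (fun y => tendsto_atBot_add_const_right _ (-y) tendsto_id) vol_atBot hL2 hc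
    subst z1 z2
    have hp := pair_le' (by positivity) hstar hgi hT hL1 hL2
    have hp2 : 2 * lam * ∫ x, conv φρ f x * h x ≤ (TV h).toReal := by
      have h1 := (le_abs_self _).trans hp
      have : 2 * lam * (1 / (2 * lam) * (TV h).toReal) = (TV h).toReal := by
        field_simp
      rw [← this]
      exact mul_le_mul_of_nonneg_left h1 (by positivity)
    have hsq : 0 ≤ ∫ x, conv φρ h x ^ 2 := integral_nonneg fun _ => sq_nonneg _
    rcases hsq.lt_or_eq with hpos | hzero
    · nlinarith [mul_pos hlam hpos]
    · have hc0 : (fun x => conv φρ h x ^ 2) =ᵐ[volume] 0 :=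
        (integral_eq_zero_iff_of_nonneg (fun _ => sq_nonneg _) hc.integrable_sq).1 hzero.symm
      have hz0 : ∫ x, conv φρ f x * h x = 0 := by
        rw [← conv_adjoint hφ hev hfi hm hC]
        refine integral_eq_zero_of_ae ?_
        filter_upwards [hc0] with x hx
        have : conv φρ h x = 0 := by simpa using hx
        simp [this]
      rw [hz0, ← hzero]
      have hTpos : 0 < (TV h).toReal := by
        refine ENNReal.toReal_pos ?_ hT.ne
        intro h0
        have h0' := (eVariationOn.eq_zero_iff h).1 h0
        refine hne (Eventually.of_forall fun x => ?_)
        have hcst : ∀ y, h y = h x := fun y => by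
          simpa using h0' y (mem_univ y) x (mem_univ x)
        have : h = fun _ => h x := funext hcst
        have hl : Tendsto h atTop (𝓝 (h x)) := by
          nth_rewrite 1 [this]; exact tendsto_const_nhds
        exact tendsto_nhds_unique hl hL1
      linarith

end
end

section
/- Let φ_σ = φ̂_σ and φ_ρ = φ̂_ρ be hat kernels, let ω > 0, let z ∈ ℬ_ω^{ij} for some i, j ∈ {0,1}, set f_σ = φ̂_σ * z, and let λ > 0. Assume σ ≤ ρ ≤ ω/2 and 2/λ + (1/(15ρ²))(−σ³ + 5ρσ² + 17ρ³) < ω. Then u = z is the unique minimiser of F₃(u) = ∫_ℝ |u′| + λ‖φ̂_ρ*u − f_σ‖²_{L²(ℝ)} over ℬ^{ij}, i.e. F₃(z) < F₃(u) for every u ∈ ℬ^{ij} with u ≠ z a.e. -/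
open MeasureTheory Set

noncomputable section

section helpers

open Filter Topology

lemma hat_eq_s3 {r : ℝ} (hr : 0 < r) (x : ℝ) : hatKernel r x = max 0 ((1 - |x| / r) / r) := by
  unfold hatKernel
  split_ifs with h
  · rw [max_eq_right]
    have : |x| / r < 1 := by rw [div_lt_one hr]; exact h
    exact div_nonneg (by linarith) hr.le
  · rw [max_eq_left]
    have : 1 ≤ |x| / r := by rw [one_le_div hr]; linarith
    exact div_nonpos_of_nonpos_of_nonneg (by linarith) hr.le

lemma hat_cont_s3 {r : ℝ} (hr : 0 < r) : Continuous (hatKernel r) := by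
  have : hatKernel r = fun x => max 0 ((1 - |x| / r) / r) := funext (hat_eq_s3 hr)
  rw [this]; fun_prop

lemma hat_nonneg {r : ℝ} (hr : 0 < r) (x : ℝ) : 0 ≤ hatKernel r x := by
  rw [hat_eq_s3 hr]; exact le_max_left _ _

lemma hat_even (r x : ℝ) : hatKernel r (-x) = hatKernel r x := by
  simp [hatKernel]

lemma hat_zero {r x : ℝ} (h : r ≤ |x|) : hatKernel r x = 0 := by
  simp [hatKernel, not_lt.mpr h]

lemma hat_anti {r : ℝ} (hr : 0 < r) {x y : ℝ} (h : |x| ≤ |y|) : hatKernel r y ≤ hatKernel r x := by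
  rw [hat_eq_s3 hr, hat_eq_s3 hr]; gcongr

lemma hat_pos {r : ℝ} (hr : 0 < r) {x : ℝ} (h : |x| < r) : 0 < hatKernel r x := by
  simp only [hatKernel, h, if_true]
  have : |x| / r < 1 := by rw [div_lt_one hr]; exact h
  exact div_pos (by linarith) hr

lemma hat_le {r : ℝ} (hr : 0 < r) (x : ℝ) : hatKernel r x ≤ 1 / r := by
  have := hat_anti hr (x := 0) (y := x) (by simp)
  simpa [hatKernel, hr] using this

lemma hat_cs {r : ℝ} : HasCompactSupport (hatKernel r) :=
  HasCompactSupport.intro (isCompact_Icc (a := -r) (b := r)) (fun x hx => hat_zero (by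
    by_contra h
    push Not at h
    rw [abs_lt] at h
    exact hx ⟨h.1.le, h.2.le⟩))

/-- odd primitive of the hat kernel -/
def hatE (r x : ℝ) : ℝ := ∫ y in (0:ℝ)..x, hatKernel r y

lemma hatE_sub {r : ℝ} (hr : 0 < r) (a b : ℝ) :
    hatE r b - hatE r a = ∫ y in a..b, hatKernel r y :=
  intervalIntegral.integral_interval_sub_left ((hat_cont_s3 hr).intervalIntegrable _ _)
    ((hat_cont_s3 hr).intervalIntegrable _ _)

lemma hatE_neg (r x : ℝ) : hatE r (-x) = - hatE r x := by
  unfold hatE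
  have := intervalIntegral.integral_comp_neg (f := hatKernel r) (a := 0) (b := x)
  simp only [hat_even, neg_zero] at this
  rw [this, intervalIntegral.integral_symm]

lemma hatE_cont {r : ℝ} (hr : 0 < r) : Continuous (hatE r) :=
  intervalIntegral.continuous_primitive (fun _ _ => (hat_cont_s3 hr).intervalIntegrable _ _) 0

lemma hatE_of_le {r x : ℝ} (hr : 0 < r) (h0 : 0 ≤ x) (hx : x ≤ r) :
    hatE r x = x / r - (x / r) ^ 2 / 2 := by
  unfold hatE
  have : ∫ y in (0:ℝ)..x, hatKernel r y = ∫ y in (0:ℝ)..x, (1 / r - (1 / r ^ 2) * y) := by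
    apply intervalIntegral.integral_congr
    intro y hy
    rw [uIcc_of_le h0] at hy
    simp only
    rw [hat_eq_s3 hr, abs_of_nonneg hy.1, max_eq_right]
    · field_simp
    · have : y / r ≤ 1 := by rw [div_le_one hr]; linarith [hy.2]
      exact div_nonneg (by linarith) hr.le
  rw [this, intervalIntegral.integral_sub (by simp) (by apply Continuous.intervalIntegrable; fun_prop),
    intervalIntegral.integral_const_mul, integral_id]
  simp
  field_simp

lemma hatE_of_ge {r x : ℝ} (hr : 0 < r) (hx : r ≤ x) : hatE r x = 1 / 2 := by
  have h1 := hatE_sub hr r x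
  have h2 : ∫ y in r..x, hatKernel r y = ∫ y in r..x, (0:ℝ) := by
    apply intervalIntegral.integral_congr
    intro y hy
    rw [uIcc_of_le hx] at hy
    exact hat_zero (hy.1.trans (le_abs_self y))
  have h3 := hatE_of_le hr hr.le le_rfl
  rw [h2] at h1
  simp at h1
  rw [div_self hr.ne'] at h3
  linarith

lemma hatE_of_le_neg {r x : ℝ} (hr : 0 < r) (hx : x ≤ -r) : hatE r x = -(1 / 2) := by
  have := hatE_neg r (-x)
  rw [neg_neg] at this
  rw [this, hatE_of_ge hr (by linarith)]

lemma hatE_min {r x : ℝ} (hr : 0 < r) (h0 : 0 ≤ x) :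
    hatE r x = min (x / r) 1 - (min (x / r) 1) ^ 2 / 2 := by
  rcases le_total x r with h | h
  · rw [hatE_of_le hr h0 h, min_eq_left ((div_le_one hr).2 h)]
  · rw [hatE_of_ge hr h, min_eq_right ((one_le_div hr).2 h)]; norm_num

/-- the difference of primitives -/
def hatD (ρ σ x : ℝ) : ℝ := hatE ρ x - hatE σ x

lemma hatD_neg (ρ σ x : ℝ) : hatD ρ σ (-x) = - hatD ρ σ x := by
  simp only [hatD, hatE_neg]; ring

lemma hatD_nonpos {ρ σ x : ℝ} (hσ : 0 < σ) (h : σ ≤ ρ) (hx : 0 ≤ x) : hatD ρ σ x ≤ 0 := by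
  have hρ : 0 < ρ := hσ.trans_le h
  rw [hatD, hatE_min hσ hx, hatE_min hρ hx]
  have h1 : min (x / ρ) 1 ≤ min (x / σ) 1 := by gcongr
  have h2 : min (x / ρ) 1 ≤ 1 := min_le_right _ _
  have h3 : min (x / σ) 1 ≤ 1 := min_le_right _ _
  nlinarith

lemma hatD_nonneg {ρ σ x : ℝ} (hσ : 0 < σ) (h : σ ≤ ρ) (hx : x ≤ 0) : 0 ≤ hatD ρ σ x := by
  have := hatD_nonpos hσ h (x := -x) (by linarith)
  rw [hatD_neg] at this; linarith

lemma hatD_zero {ρ σ x : ℝ} (hσ : 0 < σ) (h : σ ≤ ρ) (hx : ρ ≤ |x|) : hatD ρ σ x = 0 := by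
  have hρ : 0 < ρ := hσ.trans_le h
  rcases le_abs.1 hx with h1 | h1
  · rw [hatD, hatE_of_ge hρ h1, hatE_of_ge hσ (h.trans h1)]; ring
  · rw [hatD, hatE_of_le_neg hρ (by linarith), hatE_of_le_neg hσ (by linarith)]; ring

lemma hatD_cont {ρ σ : ℝ} (hσ : 0 < σ) (h : σ ≤ ρ) : Continuous (hatD ρ σ) :=
  (hatE_cont (hσ.trans_le h)).sub (hatE_cont hσ)

lemma hatD_cs {ρ σ : ℝ} (hσ : 0 < σ) (h : σ ≤ ρ) : HasCompactSupport (hatD ρ σ) :=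
  HasCompactSupport.intro (isCompact_Icc (a := -ρ) (b := ρ)) (fun x hx => hatD_zero hσ h (by
    by_contra h
    push Not at h
    rw [abs_lt] at h
    exact hx ⟨h.1.le, h.2.le⟩))

lemma hatD_int {ρ σ : ℝ} (hσ : 0 < σ) (h : σ ≤ ρ) : Integrable (hatD ρ σ) :=
  (hatD_cont hσ h).integrable_of_hasCompactSupport (hatD_cs hσ h)

/-- integrability of the convolution integrand -/
lemma conv_integrand {r : ℝ} (hr : 0 < r) {u : ℝ → ℝ} (hu : Integrable u) (x : ℝ) :
    Integrable (fun y => hatKernel r (x - y) * u y) := by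
  apply hu.bdd_mul (c := 1 / r)
  · exact ((hat_cont_s3 hr).comp (by fun_prop : Continuous fun y => x - y)).aestronglyMeasurable
  · refine Eventually.of_forall fun y => ?_
    rw [Real.norm_eq_abs, abs_of_nonneg (hat_nonneg hr _)]
    exact hat_le hr _

lemma conv_eq (φ u : ℝ → ℝ) : conv φ u = convolution u φ (ContinuousLinearMap.mul ℝ ℝ) volume := by
  ext x
  simp only [conv, convolution, ContinuousLinearMap.mul_apply']
  congr 1; ext y; ring

lemma conv_cont {r : ℝ} (hr : 0 < r) {u : ℝ → ℝ} (hu : Integrable u) :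
    Continuous (conv (hatKernel r) u) := by
  rw [conv_eq]
  exact hat_cs.continuous_convolution_right _ hu.locallyIntegrable (hat_cont_s3 hr)

lemma conv_cs {r : ℝ} {u : ℝ → ℝ} (hu : HasCompactSupport u) :
    HasCompactSupport (conv (hatKernel r) u) := by
  rw [conv_eq]
  exact HasCompactSupport.convolution _ hu hat_cs

lemma conv_sub {r : ℝ} (hr : 0 < r) {u v : ℝ → ℝ} (hu : Integrable u) (hv : Integrable v) (x : ℝ) :
    conv (hatKernel r) (fun y => u y - v y) x =
      conv (hatKernel r) u x - conv (hatKernel r) v x := by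
  simp only [conv]
  rw [← integral_sub (conv_integrand hr hu x) (conv_integrand hr hv x)]
  congr 1; ext y; ring

lemma conv_sum {r : ℝ} (hr : 0 < r) {n : ℕ} {u : ℕ → ℝ → ℝ} (hu : ∀ k, Integrable (u k)) (x : ℝ) :
    conv (hatKernel r) (fun y => ∑ k ∈ Finset.range n, u k y) x =
      ∑ k ∈ Finset.range n, conv (hatKernel r) (u k) x := by
  simp only [conv]
  rw [← integral_finsetSum _ (fun k _ => conv_integrand hr (hu k) x)]
  congr 1; ext y; rw [Finset.mul_sum]

lemma conv_shift (φ u : ℝ → ℝ) (a x : ℝ) : conv φ (fun y => u (y - a)) x = conv φ u (x - a) := by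
  simp only [conv]
  rw [← integral_add_right_eq_self _ a]
  congr 1; ext y; rw [add_sub_cancel_right, show x - (y + a) = x - a - y by ring]

lemma conv_ind {r : ℝ} (hr : 0 < r) {a b : ℝ} (hab : a ≤ b) (x : ℝ) :
    conv (hatKernel r) ((Icc a b).indicator fun _ => (1:ℝ)) x = hatE r (x - a) - hatE r (x - b) := by
  rw [hatE_sub hr]
  simp only [conv]
  have : (fun y => hatKernel r (x - y) * (Icc a b).indicator (fun _ => (1:ℝ)) y)
      = (Icc a b).indicator (fun y => hatKernel r (x - y)) := by
    ext y; by_cases h : y ∈ Icc a b <;> simp [h]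
  rw [this, integral_indicator measurableSet_Icc, integral_Icc_eq_integral_Ioc,
    ← intervalIntegral.integral_of_le hab, intervalIntegral.integral_comp_sub_left]

/-- Ψ -/
def hatP (ρ σ x : ℝ) : ℝ := conv (hatKernel ρ) (hatD ρ σ) x

lemma hatP_neg (ρ σ x : ℝ) : hatP ρ σ (-x) = - hatP ρ σ x := by
  simp only [hatP, conv]
  rw [← integral_neg_eq_self, ← integral_neg]
  congr 1; ext y
  rw [hatD_neg, show -x - -y = -(x - y) by ring, hat_even]; ring

lemma hatP_nonneg {ρ σ x : ℝ} (hσ : 0 < σ) (h : σ ≤ ρ) (hx : x ≤ 0) : 0 ≤ hatP ρ σ x := by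
  have hρ : 0 < ρ := hσ.trans_le h
  have h1 : hatP ρ σ x - hatP ρ σ (-x) =
      ∫ y, (hatKernel ρ (x - y) - hatKernel ρ (-x - y)) * hatD ρ σ y := by
    simp only [hatP, conv]
    rw [← integral_sub (conv_integrand hρ (hatD_int hσ h) x) (conv_integrand hρ (hatD_int hσ h) (-x))]
    congr 1; ext y; ring
  rw [hatP_neg] at h1
  have h2 : 0 ≤ ∫ y, (hatKernel ρ (x - y) - hatKernel ρ (-x - y)) * hatD ρ σ y := by
    apply integral_nonneg
    intro y
    simp only [Pi.zero_apply]
    rcases le_total y 0 with hy | hy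
    · apply mul_nonneg _ (hatD_nonneg hσ h hy)
      rw [sub_nonneg]; apply hat_anti hρ
      apply sq_le_sq.1; nlinarith
    · apply mul_nonneg_of_nonpos_of_nonpos _ (hatD_nonpos hσ h hy)
      rw [sub_nonpos]; apply hat_anti hρ
      apply sq_le_sq.1; nlinarith
  linarith

lemma hatP_nonpos {ρ σ x : ℝ} (hσ : 0 < σ) (h : σ ≤ ρ) (hx : 0 ≤ x) : hatP ρ σ x ≤ 0 := by
  have := hatP_nonneg hσ h (x := -x) (by linarith)
  rw [hatP_neg] at this; linarith

lemma hatP_zero {ρ σ x : ℝ} (hσ : 0 < σ) (h : σ ≤ ρ) (hx : 2 * ρ ≤ |x|) : hatP ρ σ x = 0 := by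
  simp only [hatP, conv]
  rw [← integral_zero ℝ ℝ]
  congr 1; ext y
  rcases le_total ρ |y| with hy | hy
  · rw [hatD_zero hσ h hy, mul_zero]
  · rw [hat_zero, zero_mul]
    have := abs_sub_abs_le_abs_sub x y
    linarith

namespace BarcodeRep

variable (B : BarcodeRep)

lemma t_lt {i j : ℕ} (hij : i < j) (hj : j < 2 * B.n) : B.t i < B.t j :=
  B.mono (show i < 2 * B.n by omega) (show j < 2 * B.n from hj) hij

lemma t_le {i j : ℕ} (hij : i ≤ j) (hj : j < 2 * B.n) : B.t i ≤ B.t j := by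
  rcases hij.eq_or_lt with h | h
  · rw [h]
  · exact (B.t_lt h hj).le

lemma mem_supp {x : ℝ} :
    x ∈ B.supp ↔ ∃ k < B.n, x ∈ Icc (B.t (2 * k)) (B.t (2 * k + 1)) := by
  simp only [supp, Finset.mem_range, mem_iUnion, exists_prop]

lemma fn_eq : B.fn = fun x => ∑ k ∈ Finset.range B.n,
    (Icc (B.t (2 * k)) (B.t (2 * k + 1))).indicator (fun _ => (1:ℝ)) x := by
  ext x
  by_cases hx : x ∈ B.supp
  · rw [fn, indicator_of_mem hx]
    obtain ⟨k, hk, hxk⟩ := B.mem_supp.1 hx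
    rw [Finset.sum_eq_single k, indicator_of_mem hxk]
    · intro l hl hlk
      rw [Finset.mem_range] at hl
      apply indicator_of_notMem
      intro hxl
      rcases lt_or_gt_of_ne hlk with h | h
      · have := B.t_lt (i := 2 * l + 1) (j := 2 * k) (by omega) (by omega)
        linarith [hxl.2, hxk.1]
      · have := B.t_lt (i := 2 * k + 1) (j := 2 * l) (by omega) (by omega)
        linarith [hxl.1, hxk.2]
    · intro h; exact absurd (Finset.mem_range.2 hk) h
  · rw [fn, indicator_of_notMem hx, Finset.sum_eq_zero]
    intro k hk
    apply indicator_of_notMem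
    intro h
    exact hx (B.mem_supp.2 ⟨k, Finset.mem_range.1 hk, h⟩)

lemma ind_int (a b : ℝ) : Integrable ((Icc a b).indicator (fun _ => (1:ℝ))) :=
  (integrable_indicator_iff measurableSet_Icc).2 (by simp)

lemma fn_int : Integrable B.fn := by
  rw [fn_eq]
  exact integrable_finsetSum _ fun k _ => ind_int _ _

lemma fn_01_s3 (x : ℝ) : B.fn x = 0 ∨ B.fn x = 1 := by
  by_cases hx : x ∈ B.supp
  · right; rw [fn, indicator_of_mem hx]
  · left; rw [fn, indicator_of_notMem hx]

lemma fn_out {x : ℝ} (hx : x ∉ Icc (0:ℝ) 1) : B.fn x = 0 := by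
  rw [fn, indicator_of_notMem]
  intro h
  obtain ⟨k, hk, hxk⟩ := B.mem_supp.1 h
  have h1 := B.t_le (i := 0) (j := 2 * k) (by omega) (by omega)
  have h2 := B.t_le (i := 2 * k + 1) (j := 2 * B.n - 1) (by omega) (by omega)
  have h3 := B.left (by omega)
  have h4 := B.right (by omega)
  exact hx ⟨by linarith [hxk.1], by linarith [hxk.2]⟩

lemma fn_cs : HasCompactSupport B.fn :=
  HasCompactSupport.intro (isCompact_Icc (a := (0:ℝ)) (b := 1)) (fun _ hx => B.fn_out hx)

lemma fn_even {k : ℕ} (hk : 2 * k + 1 < 2 * B.n) {x : ℝ}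
    (hx : x ∈ Ioo (B.t (2 * k)) (B.t (2 * k + 1))) : B.fn x = 1 := by
  rw [fn, indicator_of_mem]
  exact B.mem_supp.2 ⟨k, by omega, hx.1.le, hx.2.le⟩

lemma fn_odd {k : ℕ} (hk : 2 * k + 2 < 2 * B.n) {x : ℝ}
    (hx : x ∈ Ioo (B.t (2 * k + 1)) (B.t (2 * k + 2))) : B.fn x = 0 := by
  rw [fn, indicator_of_notMem]
  intro h
  obtain ⟨l, hl, hxl⟩ := B.mem_supp.1 h
  rcases le_or_gt l k with h | h
  · have := B.t_le (i := 2 * l + 1) (j := 2 * k + 1) (by omega) (by omega)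
    linarith [hxl.2, hx.1]
  · have := B.t_le (i := 2 * k + 2) (j := 2 * l) (by omega) (by omega)
    linarith [hxl.1, hx.2]

lemma fn_left_s3 {x : ℝ} (hx : x < B.t 0) : B.fn x = 0 := by
  rw [fn, indicator_of_notMem]
  intro h
  obtain ⟨l, hl, hxl⟩ := B.mem_supp.1 h
  have := B.t_le (i := 0) (j := 2 * l) (by omega) (by omega)
  linarith [hxl.1]

lemma fn_right_s3 {x : ℝ} (hx : B.t (2 * B.n - 1) < x) : B.fn x = 0 := by
  rw [fn, indicator_of_notMem]
  intro h
  obtain ⟨l, hl, hxl⟩ := B.mem_supp.1 h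
  have := B.t_le (i := 2 * l + 1) (j := 2 * B.n - 1) (by omega) (by omega)
  linarith [hxl.2]

variable {B}

lemma gap {ω : ℝ} (hB : B.MinWidth ω) {k : ℕ} (hk : k + 1 < 2 * B.n) :
    ω ≤ B.t (k + 1) - B.t k := by
  obtain ⟨h1, h2, -, -⟩ := hB
  rcases Nat.even_or_odd' k with ⟨l, rfl | rfl⟩
  · exact h1 l (by omega)
  · exact h2 l (by omega)

lemma gap' {ω : ℝ} (hB : B.MinWidth ω) {i j : ℕ} (hij : i < j) (hj : j < 2 * B.n) :
    B.t i + ω ≤ B.t j := by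
  have h1 := gap hB (k := i) (by omega)
  have h2 := B.t_le (i := i + 1) (j := j) (by omega) hj
  linarith

lemma conv_fn {r : ℝ} (hr : 0 < r) (x : ℝ) : conv (hatKernel r) B.fn x =
    ∑ k ∈ Finset.range B.n, (hatE r (x - B.t (2 * k)) - hatE r (x - B.t (2 * k + 1))) := by
  rw [fn_eq, conv_sum hr (fun k => ind_int _ _)]
  refine Finset.sum_congr rfl fun k hk => ?_
  rw [Finset.mem_range] at hk
  exact conv_ind hr (B.t_le (by omega) (by omega)) x

lemma conv_h {ρ σ : ℝ} (hσ : 0 < σ) (h : σ ≤ ρ) (x : ℝ) :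
    conv (hatKernel ρ) (fun y => conv (hatKernel ρ) B.fn y - conv (hatKernel σ) B.fn y) x =
    ∑ k ∈ Finset.range B.n, (hatP ρ σ (x - B.t (2 * k)) - hatP ρ σ (x - B.t (2 * k + 1))) := by
  have hρ : 0 < ρ := hσ.trans_le h
  have : (fun y => conv (hatKernel ρ) B.fn y - conv (hatKernel σ) B.fn y) =
      fun y => ∑ k ∈ Finset.range B.n, (hatD ρ σ (y - B.t (2 * k)) - hatD ρ σ (y - B.t (2 * k + 1))) := by
    ext y
    rw [conv_fn hρ, conv_fn hσ, ← Finset.sum_sub_distrib]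
    refine Finset.sum_congr rfl fun k _ => ?_
    simp only [hatD]; ring
  have hi : ∀ a, Integrable (fun y => hatD ρ σ (y - a)) := fun a => (hatD_int hσ h).comp_sub_right a
  rw [this, conv_sum hρ (u := fun k y => hatD ρ σ (y - B.t (2 * k)) - hatD ρ σ (y - B.t (2 * k + 1)))
    (fun k => (hi _).sub (hi _))]
  refine Finset.sum_congr rfl fun k _ => ?_
  rw [conv_sub hρ (hi _) (hi _), conv_shift, conv_shift]
  rfl

lemma conv_h_nonpos {ρ σ ω : ℝ} (hσ : 0 < σ) (h : σ ≤ ρ) (hω : 2 * ρ ≤ ω) (hB : B.MinWidth ω)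
    {x : ℝ} (hx : x ∈ B.supp) :
    conv (hatKernel ρ) (fun y => conv (hatKernel ρ) B.fn y - conv (hatKernel σ) B.fn y) x ≤ 0 := by
  rw [conv_h hσ h]
  obtain ⟨k, hk, hxk⟩ := B.mem_supp.1 hx
  apply Finset.sum_nonpos
  intro l hl
  rw [Finset.mem_range] at hl
  rcases lt_trichotomy l k with hlk | rfl | hlk
  · have h1 := gap' hB (i := 2 * l + 1) (j := 2 * k) (by omega) (by omega)
    have h2 := gap' hB (i := 2 * l) (j := 2 * k) (by omega) (by omega)
    rw [hatP_zero hσ h (le_abs.2 (Or.inl (by linarith [hxk.1]))),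
      hatP_zero hσ h (le_abs.2 (Or.inl (by linarith [hxk.1])))]
    simp
  · have h1 := hatP_nonpos hσ h (x := x - B.t (2 * l)) (by linarith [hxk.1])
    have h2 := hatP_nonneg hσ h (x := x - B.t (2 * l + 1)) (by linarith [hxk.2])
    linarith
  · have h1 := gap' hB (i := 2 * k + 1) (j := 2 * l) (by omega) (by omega)
    have h2 := gap' hB (i := 2 * k + 1) (j := 2 * l + 1) (by omega) (by omega)
    rw [hatP_zero hσ h (le_abs.2 (Or.inr (by linarith [hxk.2]))),
      hatP_zero hσ h (le_abs.2 (Or.inr (by linarith [hxk.2])))]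
    simp

lemma conv_h_nonneg {ρ σ ω : ℝ} (hσ : 0 < σ) (h : σ ≤ ρ) (hω : 2 * ρ ≤ ω) (hB : B.MinWidth ω)
    {x : ℝ} (hx : x ∉ B.supp) :
    0 ≤ conv (hatKernel ρ) (fun y => conv (hatKernel ρ) B.fn y - conv (hatKernel σ) B.fn y) x := by
  rw [conv_h hσ h]
  apply Finset.sum_nonneg
  intro l hl
  rw [Finset.mem_range] at hl
  have hg := gap' hB (i := 2 * l) (j := 2 * l + 1) (by omega) (by omega)
  rcases lt_or_ge x (B.t (2 * l)) with h1 | h1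
  · have h2 := hatP_nonneg hσ h (x := x - B.t (2 * l)) (by linarith)
    rw [hatP_zero hσ h (x := x - B.t (2 * l + 1)) (le_abs.2 (Or.inr (by linarith)))]
    linarith
  · have h3 : B.t (2 * l + 1) < x := by
      by_contra h3
      exact hx (B.mem_supp.2 ⟨l, hl, h1, not_lt.1 h3⟩)
    have h2 := hatP_nonpos hσ h (x := x - B.t (2 * l + 1)) (by linarith)
    rw [hatP_zero hσ h (x := x - B.t (2 * l)) (le_abs.2 (Or.inl (by linarith)))]
    linarith

/-- upper bound for the total variation -/
lemma TV_le_s3 : TV B.fn ≤ ENNReal.ofReal (2 * B.n) := by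
  let M : ℝ → ℝ := fun x => ∑ k ∈ Finset.range B.n,
    ((if B.t (2 * k) ≤ x then 1 else 0) + (if B.t (2 * k + 1) < x then 1 else 0))
  have hM0 : ∀ x, 0 ≤ M x := fun x => Finset.sum_nonneg fun k _ => by positivity
  have hM1 : ∀ x, M x ≤ 2 * B.n := fun x => by
    calc M x ≤ ∑ k ∈ Finset.range B.n, (2:ℝ) := Finset.sum_le_sum fun k _ => by
          split_ifs <;> norm_num
      _ = 2 * B.n := by simp [mul_comm]
  have key : ∀ x y, x ≤ y → |B.fn y - B.fn x| ≤ M y - M x := by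
    intro x y hxy
    rw [fn_eq]
    simp only [M]
    rw [← Finset.sum_sub_distrib, ← Finset.sum_sub_distrib]
    refine (Finset.abs_sum_le_sum_abs _ _).trans (Finset.sum_le_sum fun k hk => ?_)
    rw [Finset.mem_range] at hk
    have := B.t_lt (i := 2 * k) (j := 2 * k + 1) (by omega) (by omega)
    simp only [indicator, mem_Icc]
    split_ifs <;> first | (norm_num; done) | (exfalso; grind)
  apply iSup_le
  rintro ⟨n, s, hs, -⟩
  simp only
  calc ∑ i ∈ Finset.range n, edist (B.fn (s (i + 1))) (B.fn (s i))
      ≤ ∑ i ∈ Finset.range n, ENNReal.ofReal (M (s (i + 1)) - M (s i)) := by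
        apply Finset.sum_le_sum
        intro i _
        rw [edist_dist, Real.dist_eq]
        exact ENNReal.ofReal_le_ofReal (key _ _ (hs (by omega)))
    _ = ENNReal.ofReal (∑ i ∈ Finset.range n, (M (s (i + 1)) - M (s i))) := by
        rw [ENNReal.ofReal_sum_of_nonneg]
        intro i _
        exact (abs_nonneg _).trans (key _ _ (hs (by omega)))
    _ ≤ _ := by
        rw [Finset.sum_range_sub (fun i => M (s i))]
        apply ENNReal.ofReal_le_ofReal
        linarith [hM0 (s 0), hM1 (s n)]

/-- right-constancy -/
lemma right_const (B : BarcodeRep) (x : ℝ) : ∃ c, ∀ᶠ y in 𝓝[>] x, B.fn y = c := by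
  have h : ∀ k, ∃ c, ∀ᶠ y in 𝓝[>] x,
      (Icc (B.t (2 * k)) (B.t (2 * k + 1))).indicator (fun _ => (1:ℝ)) y = c := by
    intro k
    rcases lt_or_ge x (B.t (2 * k)) with h1 | h1
    · refine ⟨0, ?_⟩
      filter_upwards [Ioo_mem_nhdsGT h1] with y hy
      exact indicator_of_notMem (fun h => by linarith [h.1, hy.2]) _
    · rcases lt_or_ge x (B.t (2 * k + 1)) with h2 | h2
      · refine ⟨1, ?_⟩
        filter_upwards [Ioo_mem_nhdsGT h2] with y hy
        exact indicator_of_mem (show y ∈ Icc _ _ from ⟨by linarith [hy.1], hy.2.le⟩) _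
      · refine ⟨0, ?_⟩
        filter_upwards [self_mem_nhdsWithin] with y hy
        exact indicator_of_notMem (fun h => by linarith [h.2, mem_Ioi.1 hy]) _
  choose c hc using h
  refine ⟨∑ k ∈ Finset.range B.n, c k, ?_⟩
  have := (Filter.eventually_all_finset (Finset.range B.n)).2 (fun k _ => hc k)
  filter_upwards [this] with y hy
  rw [fn_eq]
  exact Finset.sum_congr rfl hy

end BarcodeRep

lemma fubini_conv {r : ℝ} (hr : 0 < r) {w h : ℝ → ℝ} (hw : Integrable w) (hh : Integrable h) :
    ∫ x, conv (hatKernel r) w x * h x = ∫ y, w y * conv (hatKernel r) h y := by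
  have hInt2 : Integrable (fun p : ℝ × ℝ => hatKernel r (p.1 - p.2) * (h p.1 * w p.2))
      (volume.prod volume) := by
    apply (hh.mul_prod hw).bdd_mul (c := 1 / r)
    · exact ((hat_cont_s3 hr).comp
        (by fun_prop : Continuous fun p : ℝ × ℝ => p.1 - p.2)).aestronglyMeasurable
    · refine Eventually.of_forall fun y => ?_
      rw [Real.norm_eq_abs, abs_of_nonneg (hat_nonneg hr _)]
      exact hat_le hr _
  have h1 : ∀ x, conv (hatKernel r) w x * h x = ∫ y, hatKernel r (x - y) * (h x * w y) := by
    intro x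
    simp only [conv]
    rw [← integral_mul_const]
    congr 1; ext y; ring
  have h2 : ∀ y, w y * conv (hatKernel r) h y = ∫ x, hatKernel r (x - y) * (h x * w y) := by
    intro y
    simp only [conv]
    rw [← integral_const_mul]
    congr 1; ext x
    rw [show y - x = -(x - y) by ring, hat_even]; ring
  simp_rw [h1, h2]
  exact integral_integral_swap hInt2

lemma local_pt {ρ a b c : ℝ} (hρ : 0 < ρ) (hab : a ≤ b) (hc : c = 1 ∨ c = -1) {w : ℝ → ℝ}
    (hw : Integrable w) (hw1 : ∀ x, |w x| ≤ 1) (hwc : ∀ x ∈ Ioo a b, w x = c) (x : ℝ) :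
    2 * (hatE ρ (x - a) - hatE ρ (x - b)) - 1 ≤ c * conv (hatKernel ρ) w x := by
  have e1 : conv (hatKernel ρ) (fun y => 2 * (Icc a b).indicator (fun _ => (1:ℝ)) y -
      (Icc (x - ρ) (x + ρ)).indicator (fun _ => (1:ℝ)) y) x =
      2 * (hatE ρ (x - a) - hatE ρ (x - b)) - 1 := by
    rw [conv_sub hρ ((BarcodeRep.ind_int _ _).const_mul 2) (BarcodeRep.ind_int _ _),
      conv_ind hρ (by linarith), ← conv_ind hρ hab, hatE_of_ge hρ (by linarith),
      hatE_of_le_neg hρ (by linarith)]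
    simp only [conv]
    rw [← integral_const_mul]
    norm_num
    congr 1; ext y; ring
  have e2 : c * conv (hatKernel ρ) w x = conv (hatKernel ρ) (fun y => c * w y) x := by
    simp only [conv]
    rw [← integral_const_mul]
    congr 1; ext y; ring
  rw [← e1, e2]
  simp only [conv]
  apply integral_mono_ae
  · exact conv_integrand hρ (((BarcodeRep.ind_int _ _).const_mul 2).sub (BarcodeRep.ind_int _ _)) x
  · exact conv_integrand hρ (hw.const_mul c) x
  · filter_upwards [(Set.countable_singleton a).ae_notMem volume,
      (Set.countable_singleton b).ae_notMem volume] with y hya hyb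
    by_cases hy : y ∈ Icc (x - ρ) (x + ρ)
    · apply mul_le_mul_of_nonneg_left _ (hat_nonneg hρ _)
      rw [indicator_of_mem hy]
      by_cases hy2 : y ∈ Icc a b
      · have : y ∈ Ioo a b := ⟨lt_of_le_of_ne hy2.1 (fun h => hya h.symm), lt_of_le_of_ne hy2.2 hyb⟩
        rw [indicator_of_mem hy2, hwc y this]
        rcases hc with rfl | rfl <;> norm_num
      · rw [indicator_of_notMem hy2]
        have := abs_le.1 (hw1 y)
        rcases hc with rfl | rfl <;> linarith
    · rw [hat_zero]
      · simp
      · by_contra h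
        push Not at h
        rw [abs_lt] at h
        exact hy ⟨by linarith, by linarith⟩

lemma poly_int {ρ : ℝ} (hρ : 0 < ρ) :
    ∫ x in (0:ℝ)..ρ, (2 * (x / ρ - (x / ρ) ^ 2 / 2)) ^ 2 = 8 / 15 * ρ := by
  have : ∀ x : ℝ, (2 * (x / ρ - (x / ρ) ^ 2 / 2)) ^ 2 =
      4 / ρ ^ 2 * x ^ 2 - 4 / ρ ^ 3 * x ^ 3 + 1 / ρ ^ 4 * x ^ 4 := by
    intro x; field_simp; ring
  simp_rw [this]
  rw [intervalIntegral.integral_add, intervalIntegral.integral_sub,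
    intervalIntegral.integral_const_mul, intervalIntegral.integral_const_mul,
    intervalIntegral.integral_const_mul, integral_pow, integral_pow, integral_pow]
  · push_cast; field_simp; ring
  all_goals apply Continuous.intervalIntegrable; fun_prop

lemma local_lower {ρ a b c : ℝ} (hρ : 0 < ρ) (hab : 2 * ρ ≤ b - a) (hc : c = 1 ∨ c = -1) {w : ℝ → ℝ}
    (hw : Integrable w) (hw1 : ∀ x, |w x| ≤ 1) (hwc : ∀ x ∈ Ioo a b, w x = c) :
    b - a - 14 / 15 * ρ ≤ ∫ x in a..b, (conv (hatKernel ρ) w x) ^ 2 := by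
  have hpt := local_pt hρ (by linarith) hc hw hw1 hwc
  have hF : Continuous fun x => (conv (hatKernel ρ) w x) ^ 2 := (conv_cont hρ hw).pow 2
  have hcs : ∀ x, (conv (hatKernel ρ) w x) ^ 2 = (c * conv (hatKernel ρ) w x) ^ 2 := by
    intro x; rcases hc with rfl | rfl <;> ring
  rw [← intervalIntegral.integral_add_adjacent_intervals (b := b - ρ) (hF.intervalIntegrable _ _)
      (hF.intervalIntegrable _ _),
    ← intervalIntegral.integral_add_adjacent_intervals (b := a + ρ) (c := b - ρ)
      (hF.intervalIntegrable _ _) (hF.intervalIntegrable _ _)]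
  have i1 : 8 / 15 * ρ ≤ ∫ x in a..(a + ρ), (conv (hatKernel ρ) w x) ^ 2 := by
    have e : ∫ x in a..(a + ρ), (2 * ((x - a) / ρ - ((x - a) / ρ) ^ 2 / 2)) ^ 2 = 8 / 15 * ρ := by
      rw [intervalIntegral.integral_comp_sub_right
        (fun x => (2 * (x / ρ - (x / ρ) ^ 2 / 2)) ^ 2) a, ← poly_int hρ]
      congr 1 <;> ring
    rw [← e]
    apply intervalIntegral.integral_mono_on (by linarith)
    · apply Continuous.intervalIntegrable; fun_prop
    · exact hF.intervalIntegrable _ _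
    · intro x hx
      have h1 := hpt x
      rw [hatE_of_le hρ (by linarith [hx.1]) (by linarith [hx.2]),
        hatE_of_le_neg hρ (by linarith [hx.2])] at h1
      rw [hcs]
      have h3 : 0 ≤ (x - a) / ρ := div_nonneg (by linarith [hx.1]) hρ.le
      have h4 : (x - a) / ρ ≤ 1 := (div_le_one hρ).2 (by linarith [hx.2])
      apply pow_le_pow_left₀
      · nlinarith
      · linarith
  have i3 : 8 / 15 * ρ ≤ ∫ x in (b - ρ)..b, (conv (hatKernel ρ) w x) ^ 2 := by
    have e : ∫ x in (b - ρ)..b, (2 * ((b - x) / ρ - ((b - x) / ρ) ^ 2 / 2)) ^ 2 = 8 / 15 * ρ := by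
      rw [intervalIntegral.integral_comp_sub_left
        (fun x => (2 * (x / ρ - (x / ρ) ^ 2 / 2)) ^ 2) b, ← poly_int hρ]
      congr 1 <;> ring
    rw [← e]
    apply intervalIntegral.integral_mono_on (by linarith)
    · apply Continuous.intervalIntegrable; fun_prop
    · exact hF.intervalIntegrable _ _
    · intro x hx
      have h1 := hpt x
      have h2 : hatE ρ (x - b) = - hatE ρ (b - x) := by rw [← hatE_neg]; congr 1; ring
      rw [h2, hatE_of_ge hρ (by linarith [hx.1]), hatE_of_le hρ (by linarith [hx.2])
        (by linarith [hx.1])] at h1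
      rw [hcs]
      have h3 : 0 ≤ (b - x) / ρ := div_nonneg (by linarith [hx.2]) hρ.le
      have h4 : (b - x) / ρ ≤ 1 := (div_le_one hρ).2 (by linarith [hx.1])
      apply pow_le_pow_left₀
      · nlinarith
      · linarith
  have i2 : b - ρ - (a + ρ) ≤ ∫ x in (a + ρ)..(b - ρ), (conv (hatKernel ρ) w x) ^ 2 := by
    have e : ∫ x in (a + ρ)..(b - ρ), (1:ℝ) = b - ρ - (a + ρ) := by simp
    rw [← e]
    apply intervalIntegral.integral_mono_on (by linarith)
    · apply Continuous.intervalIntegrable; fun_prop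
    · exact hF.intervalIntegrable _ _
    · intro x hx
      have h1 := hpt x
      rw [hatE_of_ge hρ (by linarith [hx.1]), hatE_of_le_neg hρ (by linarith [hx.2])] at h1
      rw [hcs]
      nlinarith
  linarith

lemma conv_ne {ρ : ℝ} (hρ : 0 < ρ) {w : ℝ → ℝ} (hout : ∀ x ∉ Icc (0:ℝ) 1, w x = 0)
    (hrc : ∀ x, ∃ c, ∀ᶠ y in 𝓝[>] x, w y = c) (hne : ¬ ∀ᵐ x, w x = 0) :
    ∃ x, conv (hatKernel ρ) w x ≠ 0 := by
  let S : Set ℝ := {c | ∀ᵐ x, x < c → w x = 0}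
  have hS0 : (0:ℝ) ∈ S := by
    refine (Eventually.of_forall fun x hx => ?_ : ∀ᵐ x, x < (0:ℝ) → w x = 0)
    exact hout x fun h => by linarith [h.1]
  have hSb : ∀ c ∈ S, c ≤ 1 := by
    intro c hc
    by_contra h
    push Not at h
    apply hne
    filter_upwards [hc] with x hx
    by_cases hxc : x < c
    · exact hx hxc
    · exact hout x fun h => by linarith [h.2]
  have hbd : BddAbove S := ⟨1, hSb⟩
  set p := sSup S with hp
  have hpS : ∀ᵐ x, x < p → w x = 0 := by
    have : ∀ n : ℕ, ∀ᵐ x, x < p - 1 / ((n:ℝ) + 1) → w x = 0 := by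
      intro n
      have hlt : p - 1 / ((n:ℝ) + 1) < p := by
        have : 0 < 1 / ((n:ℝ) + 1) := by positivity
        linarith
      obtain ⟨c, hc, hcp⟩ := exists_lt_of_lt_csSup ⟨0, hS0⟩ hlt
      filter_upwards [hc] with x hx h
      exact hx (h.trans hcp)
    filter_upwards [ae_all_iff.2 this] with x hx h
    obtain ⟨n, hn⟩ := exists_nat_one_div_lt (sub_pos.2 h)
    exact hx n (by linarith)
  obtain ⟨c, hc⟩ := hrc p
  obtain ⟨q, hq, hqc⟩ := (mem_nhdsGT_iff_exists_Ioo_subset).1 hc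
  rw [mem_Ioi] at hq
  have hc0 : c ≠ 0 := by
    rintro rfl
    have : q ∈ S := by
      filter_upwards [hpS, (Set.countable_singleton p).ae_notMem volume] with x h1 h2 h3
      rcases lt_trichotomy x p with h | h | h
      · exact h1 h
      · exact absurd h h2
      · exact hqc ⟨h, h3⟩
    linarith [le_csSup hbd this]
  set δ := min (q - p) ρ with hδ
  have hδ0 : 0 < δ := lt_min (by linarith) hρ
  have hδ1 : δ ≤ q - p := min_le_left _ _
  have hδ2 : δ ≤ ρ := min_le_right _ _
  refine ⟨p - ρ + δ, ?_⟩
  have e : conv (hatKernel ρ) w (p - ρ + δ) =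
      c * conv (hatKernel ρ) ((Icc p (p + δ)).indicator fun _ => (1:ℝ)) (p - ρ + δ) := by
    simp only [conv]
    rw [← integral_const_mul]
    apply integral_congr_ae
    filter_upwards [hpS, (Set.countable_singleton p).ae_notMem volume] with y h1 h2
    rcases lt_or_ge y p with h | h
    · rw [h1 h, indicator_of_notMem (fun h' => by linarith [h'.1])]; ring
    · have h : p < y := lt_of_le_of_ne h (fun h' => h2 h'.symm)
      rcases lt_or_ge y (p + δ) with h3 | h3
      · have : w y = c := hqc ⟨h, by linarith⟩
        rw [this, indicator_of_mem (show y ∈ Icc _ _ from ⟨h.le, h3.le⟩)]; ring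
      · rw [hat_zero (le_abs.2 (Or.inr (by linarith)))]; ring
  rw [e, conv_ind hρ (by linarith), show p - ρ + δ - p = -(ρ - δ) by ring, hatE_neg,
    hatE_of_le_neg hρ (x := p - ρ + δ - (p + δ)) (by linarith),
    hatE_of_le hρ (by linarith) (by linarith)]
  apply mul_ne_zero hc0
  have : (ρ - δ) / ρ < 1 := by rw [div_lt_one hρ]; linarith
  apply ne_of_gt
  nlinarith

lemma TV_ge (Z U : BarcodeRep) (O : Finset ℕ)
    (hO : ∀ k, k + 1 < 2 * Z.n → k ∉ O → ∃ x ∈ Ioo (Z.t k) (Z.t (k + 1)), U.fn x = Z.fn x) :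
    ENNReal.ofReal (2 * Z.n - 2 * O.card) ≤ TV U.fn := by
  rcases Nat.eq_zero_or_pos Z.n with hn | hn
  · rw [ENNReal.ofReal_of_nonpos]
    · exact zero_le
    · rw [hn]; simp
  have hx : ∀ k, ∃ x, k + 1 < 2 * Z.n → (x ∈ Ioo (Z.t k) (Z.t (k + 1)) ∧
      (k ∉ O → U.fn x = Z.fn x)) := by
    intro k
    by_cases hk : k + 1 < 2 * Z.n
    · by_cases hkO : k ∈ O
      · obtain ⟨x, hx⟩ := exists_between (Z.t_lt (Nat.lt_succ_self k) hk)
        exact ⟨x, fun _ => ⟨hx, fun h => absurd hkO h⟩⟩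
      · obtain ⟨x, hx, hx2⟩ := hO k hk hkO
        exact ⟨x, fun _ => ⟨hx, fun _ => hx2⟩⟩
    · exact ⟨0, fun h => absurd h hk⟩
  choose x hx using hx
  let s : ℕ → ℝ := fun k => if k = 0 then -1 else if k < 2 * Z.n then x (k - 1) else 2
  have hs0 : s 0 = -1 := by simp [s]
  have hs1 : ∀ k, k + 1 < 2 * Z.n → s (k + 1) = x k := by
    intro k hk; simp [s, hk]
  have hs2 : ∀ k, 2 * Z.n ≤ k → s k = 2 := by
    intro k hk
    simp only [s]
    rw [if_neg (by omega), if_neg (by omega)]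
  have hl := Z.left (by omega)
  have hr := Z.right (by omega)
  have hsm : Monotone s := by
    apply monotone_nat_of_le_succ
    intro k
    rcases lt_trichotomy (k + 1) (2 * Z.n) with h | h | h
    · rw [hs1 k h]
      have h1 := (hx k h).1.1
      rcases k with _ | k
      · rw [hs0]; linarith
      · rw [hs1 k (by omega)]
        have h2 := (hx k (by omega)).1.2
        linarith
    · rw [hs2 (k + 1) (by omega)]
      obtain ⟨l, rfl⟩ : ∃ l, k = l + 1 := ⟨k - 1, by omega⟩
      rw [hs1 l (by omega)]
      have h2 := (hx l (by omega)).1.2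
      have h3 := Z.t_le (i := l + 1) (j := 2 * Z.n - 1) (by omega) (by omega)
      linarith
    · rw [hs2 k (by omega), hs2 (k + 1) (by omega)]
  have hZ : ∀ k ≤ 2 * Z.n, Z.fn (s k) = if Even k then 0 else 1 := by
    intro k hk
    rcases k with _ | k
    · rw [hs0, Z.fn_left_s3 (by linarith)]; simp
    · rcases lt_or_ge (k + 1) (2 * Z.n) with h | h
      · rw [hs1 k h]
        have h1 := (hx k h).1
        rcases Nat.even_or_odd' k with ⟨l, rfl | rfl⟩
        · rw [Z.fn_even h h1, if_neg]
          rw [Nat.not_even_iff_odd]; exact ⟨l, rfl⟩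
        · rw [Z.fn_odd h h1, if_pos]
          exact ⟨l + 1, by ring⟩
      · rw [hs2 _ h, Z.fn_right_s3 (by linarith), if_pos]
        exact ⟨Z.n, by omega⟩
  let e : ℕ → ℝ := fun k => |U.fn (s k) - Z.fn (s k)|
  have he0 : e 0 = 0 := by
    simp only [e]
    rw [hs0, U.fn_out (fun h => by linarith [h.1]), Z.fn_out (fun h => by linarith [h.1])]; simp
  have he : ∀ k < 2 * Z.n, e (k + 1) ≤ if k ∈ O then 1 else 0 := by
    intro k hk
    rcases Nat.lt_or_ge (k + 1) (2 * Z.n) with h | h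
    · split_ifs with hkO
      · simp only [e]
        rcases U.fn_01_s3 (s (k + 1)) with h1 | h1 <;> rcases Z.fn_01_s3 (s (k + 1)) with h2 | h2 <;>
          rw [h1, h2] <;> norm_num
      · simp only [e]
        rw [hs1 k h, (hx k h).2 hkO]; simp
    · simp only [e]
      rw [hs2 _ h, U.fn_out (fun h => by linarith [h.2]), Z.fn_out (fun h => by linarith [h.2])]
      simp only [sub_self, abs_zero]
      positivity
  have hsum1 : ∑ k ∈ Finset.range (2 * Z.n), e (k + 1) ≤ O.card := by
    calc ∑ k ∈ Finset.range (2 * Z.n), e (k + 1)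
        ≤ ∑ k ∈ Finset.range (2 * Z.n), (if k ∈ O then (1:ℝ) else 0) :=
          Finset.sum_le_sum fun k hk => he k (Finset.mem_range.1 hk)
      _ ≤ O.card := by
          rw [Finset.sum_ite_mem, Finset.sum_const, nsmul_eq_mul, mul_one]
          exact_mod_cast Finset.card_le_card Finset.inter_subset_right
  have hsum2 : ∑ k ∈ Finset.range (2 * Z.n), e k ≤ ∑ k ∈ Finset.range (2 * Z.n), e (k + 1) := by
    have h1 := Finset.sum_range_succ e (2 * Z.n)
    have h2 := Finset.sum_range_succ' e (2 * Z.n)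
    have h3 : 0 ≤ e (2 * Z.n) := abs_nonneg _
    linarith
  have hstep : ∀ k < 2 * Z.n, 1 - e (k + 1) - e k ≤ |U.fn (s (k + 1)) - U.fn (s k)| := by
    intro k hk
    have h1 : |Z.fn (s (k + 1)) - Z.fn (s k)| = 1 := by
      rw [hZ _ (by omega), hZ _ (by omega)]
      rcases Nat.even_or_odd k with h | h
      · rw [if_neg (by rw [Nat.not_even_iff_odd]; exact h.add_one), if_pos h]; norm_num
      · rw [if_pos h.add_one, if_neg (by rwa [Nat.not_even_iff_odd])]; norm_num
    have h2 : |Z.fn (s (k + 1)) - Z.fn (s k)| ≤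
        |U.fn (s (k + 1)) - U.fn (s k)| + e (k + 1) + e k := by
      simp only [e]
      grind
    linarith
  calc ENNReal.ofReal (2 * Z.n - 2 * O.card)
      ≤ ENNReal.ofReal (∑ k ∈ Finset.range (2 * Z.n), |U.fn (s (k + 1)) - U.fn (s k)|) := by
        apply ENNReal.ofReal_le_ofReal
        have := Finset.sum_le_sum (fun k hk => hstep k (Finset.mem_range.1 hk))
        rw [Finset.sum_sub_distrib, Finset.sum_sub_distrib] at this
        simp only [Finset.sum_const, Finset.card_range, nsmul_eq_mul, mul_one] at this
        push_cast at this
        linarith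
    _ = ∑ k ∈ Finset.range (2 * Z.n), edist (U.fn (s (k + 1))) (U.fn (s k)) := by
        rw [ENNReal.ofReal_sum_of_nonneg (fun _ _ => abs_nonneg _)]
        refine Finset.sum_congr rfl fun k _ => ?_
        rw [edist_dist, Real.dist_eq]
    _ ≤ _ := eVariationOn.sum_le hsm (fun _ => mem_univ _)

lemma main_aux {σ ρ ω lam : ℝ} (hσ : 0 < σ) (hσρ : σ ≤ ρ) (hρω : ρ ≤ ω / 2) (hlam : 0 < lam)
    (hcond : 2 / lam + 1 / (15 * ρ^2) * (-σ^3 + 5 * ρ * σ^2 + 17 * ρ^3) < ω)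
    (Z U : BarcodeRep) (hZ : Z.MinWidth ω) (hne : ¬ U.fn =ᵐ[volume] Z.fn) :
    Fker lam (hatKernel ρ) (conv (hatKernel σ) Z.fn) Z.fn <
      Fker lam (hatKernel ρ) (conv (hatKernel σ) Z.fn) U.fn := by
  classical
  have hρ : 0 < ρ := hσ.trans_le hσρ
  set f := conv (hatKernel σ) Z.fn with hf
  have hfc : Continuous f := conv_cont hσ Z.fn_int
  have hfs : HasCompactSupport f := conv_cs Z.fn_cs
  let w : ℝ → ℝ := fun x => U.fn x - Z.fn x
  have hw : Integrable w := U.fn_int.sub Z.fn_int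
  have hw1 : ∀ x, |w x| ≤ 1 := by
    intro x
    simp only [w]
    rcases U.fn_01_s3 x with h1 | h1 <;> rcases Z.fn_01_s3 x with h2 | h2 <;>
      rw [h1, h2] <;> norm_num
  have hKc : ∀ V : BarcodeRep, Continuous (conv (hatKernel ρ) V.fn) := fun V => conv_cont hρ V.fn_int
  have hKs : ∀ V : BarcodeRep, HasCompactSupport (conv (hatKernel ρ) V.fn) := fun V => conv_cs V.fn_cs
  -- the residuals
  have hgc : ∀ V : BarcodeRep, Continuous (fun x => conv (hatKernel ρ) V.fn x - f x) :=
    fun V => (hKc V).sub hfc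
  have hgs : ∀ V : BarcodeRep, HasCompactSupport (fun x => conv (hatKernel ρ) V.fn x - f x) :=
    fun V => (hKs V).sub hfs
  have hsqi : ∀ V : BarcodeRep, Integrable (fun x => (conv (hatKernel ρ) V.fn x - f x) ^ 2) := by
    intro V
    simp_rw [pow_two]
    exact ((hgc V).mul (hgc V)).integrable_of_hasCompactSupport (hgs V).mul_right
  let A : BarcodeRep → ℝ := fun V => ∫ x, (conv (hatKernel ρ) V.fn x - f x) ^ 2
  have hfid : ∀ V : BarcodeRep, fidelity (conv (hatKernel ρ) V.fn) f = ENNReal.ofReal (A V) := by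
    intro V
    rw [fidelity, ofReal_integral_eq_lintegral_ofReal (hsqi V)
      (Eventually.of_forall fun x => sq_nonneg _)]
  have hA0 : ∀ V, 0 ≤ A V := fun V => integral_nonneg fun x => sq_nonneg _
  have hCw : ∀ x, conv (hatKernel ρ) w x = conv (hatKernel ρ) U.fn x - conv (hatKernel ρ) Z.fn x :=
    fun x => conv_sub hρ U.fn_int Z.fn_int x
  have hCc : Continuous (conv (hatKernel ρ) w) := conv_cont hρ hw
  have hCs : HasCompactSupport (conv (hatKernel ρ) w) := conv_cs (U.fn_cs.sub Z.fn_cs)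
  have hC2i : Integrable (fun x => (conv (hatKernel ρ) w x) ^ 2) := by
    simp_rw [pow_two]
    exact (hCc.mul hCc).integrable_of_hasCompactSupport hCs.mul_right
  have hChi : Integrable (fun x => conv (hatKernel ρ) w x * (conv (hatKernel ρ) Z.fn x - f x)) :=
    (hCc.mul (hgc Z)).integrable_of_hasCompactSupport hCs.mul_right
  -- expansion of the difference
  have hdiff : A U = A Z + (∫ x, (conv (hatKernel ρ) w x) ^ 2) +
      2 * ∫ x, conv (hatKernel ρ) w x * (conv (hatKernel ρ) Z.fn x - f x) := by
    have hsum : Integrable (fun x => (conv (hatKernel ρ) Z.fn x - f x) ^ 2 +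
        (conv (hatKernel ρ) w x) ^ 2) := (hsqi Z).add hC2i
    simp only [A]
    rw [← integral_const_mul, ← integral_add (hsqi Z) hC2i,
      ← integral_add hsum (hChi.const_mul 2)]
    congr 1; ext x
    rw [hCw x]; ring
  have hcross : 0 ≤ ∫ x, conv (hatKernel ρ) w x * (conv (hatKernel ρ) Z.fn x - f x) := by
    rw [fubini_conv hρ hw ((hgc Z).integrable_of_hasCompactSupport (hgs Z))]
    apply integral_nonneg
    intro x
    simp only [Pi.zero_apply]
    by_cases hx : x ∈ Z.supp
    · apply mul_nonneg_of_nonpos_of_nonpos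
      · simp only [w]
        have : Z.fn x = 1 := by rw [BarcodeRep.fn, indicator_of_mem hx]
        rcases U.fn_01_s3 x with h | h <;> rw [h, this] <;> norm_num
      · exact BarcodeRep.conv_h_nonpos hσ hσρ (by linarith) hZ hx
    · apply mul_nonneg
      · simp only [w]
        have : Z.fn x = 0 := by rw [BarcodeRep.fn, indicator_of_notMem hx]
        rcases U.fn_01_s3 x with h | h <;> rw [h, this] <;> norm_num
      · exact BarcodeRep.conv_h_nonneg hσ hσρ (by linarith) hZ hx
  -- positivity
  have hpos : 0 < ∫ x, (conv (hatKernel ρ) w x) ^ 2 := by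
    have hex : ∃ x, conv (hatKernel ρ) w x ≠ 0 := by
      apply conv_ne hρ
      · intro x hx
        simp only [w]
        rw [U.fn_out hx, Z.fn_out hx, sub_zero]
      · intro x
        obtain ⟨c, hc⟩ := U.right_const x
        obtain ⟨d, hd⟩ := Z.right_const x
        refine ⟨c - d, ?_⟩
        filter_upwards [hc, hd] with y h1 h2
        simp only [w]
        rw [h1, h2]
      · intro h
        apply hne
        filter_upwards [h] with x hx
        exact sub_eq_zero.1 hx
    obtain ⟨x, hx⟩ := hex
    have hC2s : HasCompactSupport (fun x => (conv (hatKernel ρ) w x) ^ 2) := by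
      simp_rw [pow_two]
      exact hCs.mul_right
    exact (hCc.pow 2).integral_pos_of_hasCompactSupport_nonneg_nonzero
      hC2s (fun y => sq_nonneg _) (x := x) (pow_ne_zero 2 hx)
  -- the opposite intervals
  let O : Finset ℕ := (Finset.range (2 * Z.n - 1)).filter
    (fun k => ∀ x ∈ Ioo (Z.t k) (Z.t (k + 1)), U.fn x ≠ Z.fn x)
  have hTV := TV_ge Z U O (by
    intro k hk hkO
    simp only [O, Finset.mem_filter, Finset.mem_range, not_and] at hkO
    have := hkO (by omega)
    push Not at this
    exact this)
  have hOk : ∀ k ∈ O, ω - 14 / 15 * ρ ≤ ∫ x in Z.t k..Z.t (k + 1), (conv (hatKernel ρ) w x) ^ 2 := by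
    intro k hk
    simp only [O, Finset.mem_filter, Finset.mem_range] at hk
    obtain ⟨hk1, hk2⟩ := hk
    have hg := BarcodeRep.gap hZ (k := k) (by omega)
    have hc : ∃ c : ℝ, (c = 1 ∨ c = -1) ∧ ∀ x ∈ Ioo (Z.t k) (Z.t (k + 1)), w x = c := by
      rcases Nat.even_or_odd' k with ⟨l, rfl | rfl⟩
      · refine ⟨-1, Or.inr rfl, fun x hx => ?_⟩
        have h1 := hk2 x hx
        simp only [w]
        rw [Z.fn_even (by omega) hx] at h1 ⊢
        rcases U.fn_01_s3 x with h | h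
        · rw [h]; norm_num
        · exact absurd h h1
      · refine ⟨1, Or.inl rfl, fun x hx => ?_⟩
        have h1 := hk2 x hx
        simp only [w]
        rw [Z.fn_odd (by omega) hx] at h1 ⊢
        rcases U.fn_01_s3 x with h | h
        · exact absurd h h1
        · rw [h]; norm_num
    obtain ⟨c, hc, hwc⟩ := hc
    have := local_lower hρ (by linarith) hc hw hw1 hwc
    linarith
  have hlow : O.card * (ω - 14 / 15 * ρ) ≤ ∫ x, (conv (hatKernel ρ) w x) ^ 2 := by
    have hii : ∀ a b, IntervalIntegrable (fun x => (conv (hatKernel ρ) w x) ^ 2) volume a b :=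
      fun a b => (hCc.pow 2).intervalIntegrable a b
    have hle : Z.t 0 ≤ Z.t (2 * Z.n - 1) := by
      rcases Nat.eq_zero_or_pos Z.n with hn | hn
      · rw [hn]
      · exact Z.t_le (by omega) (by omega)
    calc O.card * (ω - 14 / 15 * ρ) = ∑ k ∈ O, (ω - 14 / 15 * ρ) := by
          rw [Finset.sum_const, nsmul_eq_mul]
      _ ≤ ∑ k ∈ O, ∫ x in Z.t k..Z.t (k + 1), (conv (hatKernel ρ) w x) ^ 2 :=
          Finset.sum_le_sum hOk
      _ ≤ ∑ k ∈ Finset.range (2 * Z.n - 1),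
            ∫ x in Z.t k..Z.t (k + 1), (conv (hatKernel ρ) w x) ^ 2 := by
          apply Finset.sum_le_sum_of_subset_of_nonneg (Finset.filter_subset _ _)
          intro k hk _
          rw [Finset.mem_range] at hk
          exact intervalIntegral.integral_nonneg (Z.t_le (by omega) (by omega))
            (fun x _ => sq_nonneg _)
      _ = ∫ x in Z.t 0..Z.t (2 * Z.n - 1), (conv (hatKernel ρ) w x) ^ 2 :=
          intervalIntegral.sum_integral_adjacent_intervals (fun k _ => hii _ _)
      _ ≤ _ := by
          rw [intervalIntegral.integral_of_le hle]
          exact setIntegral_le_integral hC2i (Eventually.of_forall fun x => sq_nonneg _)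
  have hkey : 2 * Z.n + lam * A Z < (2 * Z.n - 2 * O.card) + lam * A U := by
    have h1 : A Z < A U := by linarith
    rcases Nat.eq_zero_or_pos O.card with h0 | h0
    · rw [h0]
      have := mul_lt_mul_of_pos_left h1 hlam
      push_cast
      linarith
    · have hC : 14 / 15 * ρ ≤ 1 / (15 * ρ^2) * (-σ^3 + 5 * ρ * σ^2 + 17 * ρ^3) := by
        rw [one_div, inv_mul_eq_div, le_div_iff₀ (by positivity)]
        have : 0 ≤ (ρ - σ) * σ ^ 2 := mul_nonneg (by linarith) (by positivity)
        have : 0 ≤ ρ * σ ^ 2 := by positivity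
        have : 0 ≤ ρ ^ 3 := by positivity
        nlinarith
      have h2 : 2 / lam < ω - 14 / 15 * ρ := by linarith
      rw [div_lt_iff₀ hlam] at h2
      have h3 : (0:ℝ) < O.card := by exact_mod_cast h0
      have h4 := mul_lt_mul_of_pos_left h2 h3
      have h5 : O.card * (ω - 14 / 15 * ρ) ≤ A U - A Z := by linarith
      have h6 := mul_le_mul_of_nonneg_left h5 hlam.le
      nlinarith
  have hl0 : 0 ≤ 2 * (Z.n:ℝ) + lam * A Z := by have := hA0 Z; positivity
  rw [Fker, Fker, hfid, hfid, ← ENNReal.ofReal_mul hlam.le, ← ENNReal.ofReal_mul hlam.le]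
  calc TV Z.fn + ENNReal.ofReal (lam * A Z)
      ≤ ENNReal.ofReal (2 * Z.n) + ENNReal.ofReal (lam * A Z) := by
        gcongr; exact BarcodeRep.TV_le_s3
    _ = ENNReal.ofReal (2 * Z.n + lam * A Z) :=
        (ENNReal.ofReal_add (by positivity) (mul_nonneg hlam.le (hA0 Z))).symm
    _ < ENNReal.ofReal ((2 * Z.n - 2 * O.card) + lam * A U) :=
        (ENNReal.ofReal_lt_ofReal_iff (by linarith)).2 hkey
    _ ≤ ENNReal.ofReal (2 * Z.n - 2 * O.card) + ENNReal.ofReal (lam * A U) := ENNReal.ofReal_add_le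
    _ ≤ TV U.fn + ENNReal.ofReal (lam * A U) := by gcongr

end helpers

/-- Theorem 2, part 2: for hat kernels `φ̂_σ, φ̂_ρ`,
`z ∈ ℬ_ω^{ij}`, `σ ≤ ρ ≤ ω/2` and `2/λ + (1/(15ρ²))(−σ³ + 5ρσ² + 17ρ³) < ω`,
`z` is the unique minimiser of `F₃` over `ℬ^{ij}`. -/
theorem statement3 (σ ρ ω lam : ℝ) (hσ : 0 < σ) (hσρ : σ ≤ ρ) (hρω : ρ ≤ ω / 2)
    (hω : 0 < ω) (i j : ℝ) (hi : i = 0 ∨ i = 1) (hj : j = 0 ∨ j = 1)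
    (z : ℝ → ℝ) (hz : IsBarcodeW z ω) (hzij : InBij z i j) (hlam : 0 < lam)
    (hcond : 2 / lam + 1 / (15 * ρ^2) * (-σ^3 + 5 * ρ * σ^2 + 17 * ρ^3) < ω) :
    ∀ u : ℝ → ℝ, IsBarcode u → InBij u i j → ¬ u =ᵐ[volume] z →
      Fker lam (hatKernel ρ) (conv (hatKernel σ) z) z <
        Fker lam (hatKernel ρ) (conv (hatKernel σ) z) u := by
  intro u hu _ hne
  obtain ⟨Z, rfl, hZ⟩ := hz
  obtain ⟨U, rfl⟩ := hu
  exact main_aux hσ hσρ hρω hlam hcond Z U hZ hne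

end
end
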